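/- arXiv:math/0306275 — 7 statements merged into one kernel-verified Lean document; each statement's English description precedes it below -/
import Mathlib

section
/- The ideal J is a radical ideal of R. -/
noncomputable section

/-- Pairs of `n × n` complex matrices are points of `ℂ^{2n²}`. -/
abbrev MatC (n : ℕ) := Matrix (Fin n) (Fin n) ℂ

/-- The polynomial ring `R = ℂ[x_{ij}, y_{ij}]` in `2n²` variables. -/
abbrev PolyRing (n : ℕ) := MvPolynomial ((Fin n × Fin n) ⊕ (Fin n × Fin n)) ℂ

/-- The generic matrix `X = (x_{ij})`. -/
def Xgen (n : ℕ) : Matrix (Fin n) (Fin n) (PolyRing n) :=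
  Matrix.of fun i j => MvPolynomial.X (Sum.inl (i, j))

/-- The generic matrix `Y = (y_{ij})`. -/
def Ygen (n : ℕ) : Matrix (Fin n) (Fin n) (PolyRing n) :=
  Matrix.of fun i j => MvPolynomial.X (Sum.inr (i, j))

/-- The ideal `J` generated by the strictly upper-triangular entries of `XY`
together with the strictly lower-triangular entries of `YX`. -/
def upperLowerIdeal (n : ℕ) : Ideal (PolyRing n) :=
  Ideal.span ({ f | ∃ i j : Fin n, i < j ∧ f = (Xgen n * Ygen n) i j } ∪
              { f | ∃ i j : Fin n, j < i ∧ f = (Ygen n * Xgen n) i j })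

/-- Gaussian elimination: if `XY` is lower triangular and `YX` is upper triangular, then all
entries of `X` and `Y` are rational functions of the diagonal entries of `XY` and of at most
`a * b` further elements. -/
theorem exists_finset_generating_entries {K : Type*} [Field K] (a : ℕ) :
    ∀ (b : ℕ) (X : Matrix (Fin a) (Fin b) K) (Y : Matrix (Fin b) (Fin a) K),
      (∀ i j, i < j → (X * Y) i j = 0) → (∀ i j, j < i → (Y * X) i j = 0) →
      ∃ S : Finset K, S.card ≤ a * b ∧ ∀ F : Subfield K, (S : Set K) ⊆ F →
        (∀ i, (X * Y) i i ∈ F) → ∀ i j, X i j ∈ F ∧ Y j i ∈ F := by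
  classical
  induction a with
  | zero => exact fun b X Y _ _ => ⟨∅, by simp, fun F _ _ i => i.elim0⟩
  | succ a ih =>
    intro b X Y hXY hYX
    by_cases hrow : ∀ j, X 0 j = 0
    · have e1 : ∀ i j, (X.submatrix Fin.succ id * Y.submatrix id Fin.succ) i j
          = (X * Y) i.succ j.succ := fun i j => by simp [Matrix.mul_apply]
      have e2 : ∀ i j, (Y.submatrix id Fin.succ * X.submatrix Fin.succ id) i j
          = (Y * X) i j := fun i j => by simp [Matrix.mul_apply, Fin.sum_univ_succ, hrow]
      obtain ⟨S, hS, hF⟩ := ih b (X.submatrix Fin.succ id) (Y.submatrix id Fin.succ)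
        (fun i j h => by rw [e1]; exact hXY _ _ (Fin.succ_lt_succ_iff.2 h))
        (fun i j h => by rw [e2]; exact hYX _ _ h)
      refine ⟨S ∪ Finset.univ.image (fun j => Y j 0), ?_, fun F hSF hd => ?_⟩
      · have h1 := Finset.card_union_le S (Finset.univ.image (fun j => Y j 0))
        have h2 : (Finset.univ.image (fun j => Y j 0)).card ≤ b :=
          Finset.card_image_le.trans (by simp)
        nlinarith
      · rw [Finset.coe_union, Set.union_subset_iff] at hSF
        have key := hF F hSF.1 (fun i => by rw [e1]; exact hd _)
        intro i j
        cases i using Fin.cases with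
        | zero => exact ⟨by rw [hrow]; exact F.zero_mem, hSF.2 (by simp)⟩
        | succ i => exact key i j
    · have hrow' : ∃ p, X 0 p ≠ 0 ∧ ∀ j < p, X 0 j = 0 := by
        push Not at hrow
        obtain ⟨p, hp, hmin⟩ := WellFounded.has_min (wellFounded_lt (α := Fin b))
          {p | X 0 p ≠ 0} hrow
        exact ⟨p, hp, fun j hj => by_contra fun h => hmin j h hj⟩
      obtain ⟨p, hp, hlt⟩ := hrow'
      obtain _ | b := b
      · exact p.elim0
      set t := X 0 p with ht
      let X' : Matrix (Fin a) (Fin b) K := Matrix.of fun i j =>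
        X i.succ (p.succAbove j) - X i.succ p * X 0 (p.succAbove j) / t
      let Y' : Matrix (Fin b) (Fin a) K := Matrix.of fun j i => Y (p.succAbove j) i.succ
      have e1 : ∀ i j, (X' * Y') i j = (X * Y) i.succ j.succ := by
        intro i j
        have h0 := hXY 0 j.succ (Fin.succ_pos j)
        rw [Matrix.mul_apply, Fin.sum_univ_succAbove _ p] at h0
        have h1 : Y p j.succ
            = -(∑ k, X 0 (p.succAbove k) * Y (p.succAbove k) j.succ) / t := by
          rw [eq_div_iff hp]; linear_combination h0
        calc (X' * Y') i j = ∑ k, (X i.succ (p.succAbove k) * Y (p.succAbove k) j.succ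
              - X i.succ p / t * (X 0 (p.succAbove k) * Y (p.succAbove k) j.succ)) := by
              rw [Matrix.mul_apply]
              refine Finset.sum_congr rfl fun k _ => ?_
              simp only [X', Y', Matrix.of_apply]
              ring
          _ = (X * Y) i.succ j.succ := by
              rw [Finset.sum_sub_distrib, ← Finset.mul_sum, Matrix.mul_apply,
                Fin.sum_univ_succAbove _ p, h1]
              ring
      have e2 : ∀ i j, (Y' * X') i j = (Y * X) (p.succAbove i) (p.succAbove j)
          - (Y * X) (p.succAbove i) p * X 0 (p.succAbove j) / t := by
        intro i j
        calc (Y' * X') i j = ∑ k : Fin a, (Y (p.succAbove i) k.succ * X k.succ (p.succAbove j)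
              - Y (p.succAbove i) k.succ * X k.succ p * (X 0 (p.succAbove j) / t)) := by
              rw [Matrix.mul_apply]
              refine Finset.sum_congr rfl fun k _ => ?_
              simp only [X', Y', Matrix.of_apply]
              ring
          _ = _ := by
              rw [Finset.sum_sub_distrib, ← Finset.sum_mul, Matrix.mul_apply, Matrix.mul_apply,
                Fin.sum_univ_succ, Fin.sum_univ_succ, ← ht]
              field_simp
              ring
      obtain ⟨S, hS, hF⟩ := ih b X' Y'
        (fun i j h => by rw [e1]; exact hXY _ _ (Fin.succ_lt_succ_iff.2 h))
        (fun i j h => by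
          have h' : p.succAbove j < p.succAbove i := p.succAbove_lt_succAbove_iff.2 h
          rw [e2, hYX _ _ h']
          rcases lt_or_ge (p.succAbove j) p with hj | hj
          · simp [hlt _ hj]
          · simp [hYX _ _ (hj.trans_lt h')])
      let z : Fin (b + 1) → K := fun j => if j < p then Y j 0 else X 0 j
      refine ⟨S ∪ (Finset.univ.image z ∪ Finset.univ.image fun i : Fin a => X i.succ p), ?_,
        fun F hSF hd => ?_⟩
      · have h1 := Finset.card_union_le S
          (Finset.univ.image z ∪ Finset.univ.image fun i : Fin a => X i.succ p)
        have h2 := Finset.card_union_le (Finset.univ.image z)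
          (Finset.univ.image fun i : Fin a => X i.succ p)
        have h3 : (Finset.univ.image z).card ≤ b + 1 := Finset.card_image_le.trans (by simp)
        have h4 : (Finset.univ.image fun i : Fin a => X i.succ p).card ≤ a :=
          Finset.card_image_le.trans (by simp)
        nlinarith
      · simp only [Finset.coe_union, Set.union_subset_iff] at hSF
        obtain ⟨hS1, hS2, hS3⟩ := hSF
        have key := hF F hS1 (fun i => by rw [e1]; exact hd _)
        have hz : ∀ j, z j ∈ F := fun j => hS2 (by simp)
        have hXp : ∀ i : Fin a, X i.succ p ∈ F := fun i => hS3 (by simp)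
        have hX0 : ∀ j, X 0 j ∈ F := fun j => by
          rcases lt_or_ge j p with hj | hj
          · rw [hlt j hj]; exact F.zero_mem
          · simpa [z, not_lt.2 hj] using hz j
        have htF : t ∈ F := hX0 p
        have hX : ∀ i j, X i j ∈ F := by
          intro i j
          cases i using Fin.cases with
          | zero => exact hX0 j
          | succ i =>
            rcases Fin.eq_self_or_eq_succAbove p j with rfl | ⟨j, rfl⟩
            · exact hXp i
            · have h := F.add_mem (key i j).1
                (F.div_mem (F.mul_mem (hXp i) (hX0 (p.succAbove j))) htF)
              simpa [X'] using h
        have hYs : ∀ i : Fin a, ∀ j, Y j i.succ ∈ F := by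
          intro i j
          rcases Fin.eq_self_or_eq_succAbove p j with rfl | ⟨j, rfl⟩
          · have h0 := hXY 0 i.succ (Fin.succ_pos i)
            rw [Matrix.mul_apply, Fin.sum_univ_succAbove _ j] at h0
            have h1 : Y j i.succ
                = -(∑ k, X 0 (j.succAbove k) * Y (j.succAbove k) i.succ) / t := by
              rw [eq_div_iff hp]; linear_combination h0
            rw [h1]
            exact F.div_mem (F.neg_mem (F.sum_mem fun k _ =>
              F.mul_mem (hX0 _) (key i k).2)) htF
          · exact (key i j).2
        have hY0 : ∀ j, j ≠ p → Y j 0 ∈ F := by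
          intro j hj
          rcases lt_or_gt_of_ne hj with hj | hj
          · simpa [z, hj] using hz j
          · have h0 := hYX j p hj
            rw [Matrix.mul_apply, Fin.sum_univ_succ, ← ht] at h0
            have h1 : Y j 0 = -(∑ k : Fin a, Y j k.succ * X k.succ p) / t := by
              rw [eq_div_iff hp]; linear_combination h0
            rw [h1]
            exact F.div_mem (F.neg_mem (F.sum_mem fun k _ =>
              F.mul_mem (hYs k j) (hXp k))) htF
        have hYp : Y p 0 ∈ F := by
          have h0 := hd 0
          rw [Matrix.mul_apply, Fin.sum_univ_succAbove _ p, ← ht] at h0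
          have h1 := F.sub_mem h0 (F.sum_mem (t := Finset.univ)
            (f := fun k => X 0 (p.succAbove k) * Y (p.succAbove k) 0) fun k _ =>
            F.mul_mem (hX0 _) (hY0 _ (p.succAbove_ne k)))
          rw [add_sub_cancel_right] at h1
          simpa [mul_div_cancel_left₀ _ hp] using F.div_mem h1 htF
        intro i j
        refine ⟨hX i j, ?_⟩
        cases i using Fin.cases with
        | zero =>
          by_cases hj : j = p
          · exact hj ▸ hYp
          · exact hY0 j hj
        | succ i => exact hYs i j

open IntermediateField.algebraAdjoinAdjoin in
theorem trdeg_le_of_adjoin_eq_top {k K : Type*} [Field k] [Field K] [Algebra k K] (S : Finset K)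
    (hS : IntermediateField.adjoin k (S : Set K) = ⊤) : Algebra.trdeg k K ≤ S.card := by
  have : Algebra.IsAlgebraic (Algebra.adjoin k (S : Set K)) K := by
    refine ⟨fun x => ?_⟩
    have hx : x ∈ IntermediateField.adjoin k (S : Set K) := hS ▸ trivial
    have h := Algebra.IsAlgebraic.isAlgebraic (R := Algebra.adjoin k (S : Set K))
      (⟨x, hx⟩ : IntermediateField.adjoin k (S : Set K))
    have h2 := h.algHom (IsScalarTower.toAlgHom (Algebra.adjoin k (S : Set K))
      (IntermediateField.adjoin k (S : Set K)) K)
    exact h2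
  simpa using Algebra.IsAlgebraic.trdeg_le_cardinalMk k (S : Set K)

open Classical in
/-- A domain generated by the entries of two square matrices `X`, `Y` such that `XY` is lower
triangular and `YX` is upper triangular has small transcendence degree. -/
theorem trdeg_le_of_triangular {k A : Type*} [Field k] [CommRing A] [IsDomain A] [Algebra k A]
    {n : ℕ} (X Y : Matrix (Fin n) (Fin n) A)
    (hXY : ∀ i j, i < j → (X * Y) i j = 0) (hYX : ∀ i j, j < i → (Y * X) i j = 0)
    (hgen : ∀ B : Subalgebra k A, (∀ i j, X i j ∈ B) → (∀ i j, Y i j ∈ B) → B = ⊤) :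
    Algebra.trdeg k A ≤
      ((n * n + (Finset.univ.image fun i => (X * Y) i i).card : ℕ) : Cardinal) := by
  let K := FractionRing A
  let φ : A →+* K := algebraMap A K
  have hφ : Function.Injective φ := IsFractionRing.injective A K
  have hmulX : ∀ i j, (X.map φ * Y.map φ) i j = φ ((X * Y) i j) := fun i j => by
    rw [← Matrix.map_mul, Matrix.map_apply]
  have hmulY : ∀ i j, (Y.map φ * X.map φ) i j = φ ((Y * X) i j) := fun i j => by
    rw [← Matrix.map_mul, Matrix.map_apply]
  obtain ⟨S, hS, hF⟩ := exists_finset_generating_entries n n (X.map φ) (Y.map φ)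
    (fun i j h => by rw [hmulX, hXY i j h, map_zero])
    (fun i j h => by rw [hmulY, hYX i j h, map_zero])
  let D : Finset A := Finset.univ.image fun i => (X * Y) i i
  let T : Finset K := S ∪ D.image φ
  have hT : T.card ≤ n * n + D.card :=
    (Finset.card_union_le _ _).trans (add_le_add hS Finset.card_image_le)
  have htop : IntermediateField.adjoin k (T : Set K) = ⊤ := by
    set F := IntermediateField.adjoin k (T : Set K)
    have hTF : (T : Set K) ⊆ F := IntermediateField.subset_adjoin k _
    have key := hF F.toSubfield
      (fun x hx => hTF (by simp only [T, Finset.coe_union]; exact Or.inl hx))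
      (fun i => hTF (by
        rw [hmulX]
        exact Finset.mem_coe.2 (Finset.mem_union_right _ (Finset.mem_image_of_mem _
          (Finset.mem_image_of_mem _ (Finset.mem_univ i))))))
    have hB := hgen (F.toSubalgebra.comap (IsScalarTower.toAlgHom k A K))
      (fun i j => (key i j).1) (fun i j => (key j i).2)
    have hA : ∀ x : A, φ x ∈ F := fun x => by
      have : x ∈ F.toSubalgebra.comap (IsScalarTower.toAlgHom k A K) := hB ▸ trivial
      exact this
    refine eq_top_iff.2 fun x _ => ?_
    obtain ⟨u, v, -, rfl⟩ := IsFractionRing.div_surjective (A := A) x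
    exact F.div_mem (hA u) (hA v)
  calc Algebra.trdeg k A ≤ Algebra.trdeg k K :=
        trdeg_le_of_injective (IsScalarTower.toAlgHom k A K) hφ
    _ ≤ T.card := trdeg_le_of_adjoin_eq_top T htop
    _ ≤ _ := by exact_mod_cast hT

theorem trdeg_lt_of_surjective_of_not_injective {k A B : Type} [Field k] [CommRing A] [IsDomain A]
    [CommRing B] [IsDomain B] [Algebra k A] [Algebra k B] [Algebra.FiniteType k A]
    (f : A →ₐ[k] B) (hf : Function.Surjective f) (hinj : ¬ Function.Injective f) :
    Algebra.trdeg k B < Algebra.trdeg k A := by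
  by_contra! hle
  have hfinB : Algebra.FiniteType k B := Algebra.FiniteType.of_surjective f hf
  obtain ⟨ι, x, hx⟩ := exists_isTranscendenceBasis' k B
  have hcard := hx.cardinalMk_eq_trdeg
  have hι : Finite ι := Cardinal.mk_lt_aleph0_iff.1 (hcard ▸ trdeg_lt_aleph0_of_finiteType)
  choose y hy using fun i => hf (x i)
  have hfy : f ∘ y = x := funext hy
  have hy_ind : AlgebraicIndependent k y := AlgebraicIndependent.of_comp f (hfy ▸ hx.1)
  have hy_bas : IsTranscendenceBasis k y :=
    hy_ind.isTranscendenceBasis_of_trdeg_le_of_finite (hle.trans hcard.ge)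
  have halg := hy_bas.isAlgebraic
  obtain ⟨z, hz, hz0⟩ : ∃ z, f z = 0 ∧ z ≠ 0 := by
    rw [injective_iff_map_eq_zero] at hinj
    push Not at hinj
    exact hinj
  have hne := Ideal.comap_ne_bot_of_algebraic_mem (R := Algebra.adjoin k (Set.range y))
    (I := RingHom.ker f) hz0 hz (halg.isAlgebraic z)
  refine hne (eq_bot_iff.2 fun w hw => ?_)
  obtain ⟨w, hw'⟩ := w
  obtain ⟨p, rfl⟩ : ∃ p, MvPolynomial.aeval y p = w := by
    rwa [Algebra.adjoin_range_eq_range_aeval] at hw'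
  have h0 : f (MvPolynomial.aeval y p) = 0 := hw
  rw [MvPolynomial.comp_aeval_apply] at h0
  have hp : p = 0 := hx.1.eq_zero_of_aeval_eq_zero p (by rw [← hfy]; exact h0)
  subst hp
  exact Subtype.ext (map_zero _)

open CategoryTheory Abelian Limits Pointwise IsLocalRing RingTheory.Sequence in
theorem exists_isRegular_quotSMulTop {A M : Type} [CommRing A] [IsLocalRing A] [IsNoetherianRing A]
    [AddCommGroup M] [Module A M] [Module.Finite A M] [Nontrivial M] {x : A}
    (hxm : x ∈ maximalIdeal A) (hx : IsSMulRegular M x) {d : ℕ}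
    (h : ∃ rs : List A, rs.length = d + 1 ∧ (∀ r ∈ rs, r ∈ maximalIdeal A) ∧ IsRegular M rs) :
    ∃ rs : List A, rs.length = d ∧ (∀ r ∈ rs, r ∈ maximalIdeal A) ∧
      IsRegular (QuotSMulTop x M) rs := by
  have hlt : ∀ (L : Type) [AddCommGroup L] [Module A L] [Module.Finite A L] [Nontrivial L],
      maximalIdeal A • (⊤ : Submodule A L) < ⊤ := fun L _ _ _ _ =>
    (Submodule.top_ne_ideal_smul_of_le_jacobson_annihilator
      (IsLocalRing.maximalIdeal_le_jacobson _)).symm.lt_top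
  have : Nontrivial (QuotSMulTop x M) := nontrivial_quotSMulTop_of_mem_maximalIdeal M hxm
  have hM := (ModuleCat.exists_isRegular_tfae (maximalIdeal A) (d + 1) (ModuleCat.of A M)
    (hlt M)).out 3 1
  have hQ := (ModuleCat.exists_isRegular_tfae (maximalIdeal A) d
    (ModuleCat.of A (QuotSMulTop x M)) (hlt _)).out 1 3
  have h_ext := hM.mp h
  refine hQ.mp fun i hi => ?_
  have zero1 := AddCommGrpCat.isZero_of_iff_subsingleton.mpr (h_ext i (by omega))
  have zero2 := AddCommGrpCat.isZero_of_iff_subsingleton.mpr (h_ext (i + 1) (by omega))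
  have hx' : IsSMulRegular (ModuleCat.of A M) x := hx
  exact AddCommGrpCat.subsingleton_of_isZero <| ShortComplex.Exact.isZero_of_both_zeros
    ((Ext.covariant_sequence_exact₃' _ hx'.smulShortComplex_shortExact) i (i + 1) rfl)
    (zero1.eq_zero_of_src _) (zero2.eq_zero_of_tgt _)

open Pointwise IsLocalRing RingTheory.Sequence in
/-- Ischebeck: the depth of a module is at most the dimension of its associated primes. -/
theorem length_le_ringKrullDim_quotient_of_mem_associatedPrimes {A : Type} [CommRing A]
    [IsLocalRing A] [IsNoetherianRing A] (rs : List A) :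
    ∀ (M : Type) [AddCommGroup M] [Module A M] [Module.Finite A M] (p : Ideal A),
      p ∈ associatedPrimes A M → (∀ r ∈ rs, r ∈ maximalIdeal A) → IsWeaklyRegular M rs →
      (rs.length : WithBot ℕ∞) ≤ ringKrullDim (A ⧸ p) := by
  induction rs with
  | nil =>
    intro M _ _ _ p hp _ _
    have := hp.isPrime
    simpa using ringKrullDim_nonneg_of_nontrivial
  | cons x rs ih =>
    intro M _ _ _ p hp hrs hreg
    have hpp := hp.isPrime
    obtain ⟨hx, hreg⟩ := (isWeaklyRegular_cons_iff M x rs).mp hreg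
    have hxm := hrs x (by simp)
    obtain ⟨-, m, hm⟩ := (Submodule.isAssociatedPrime_iff).mp hp
    have hxp : x ∉ p := by
      intro h
      rw [hm, Submodule.mem_colon_singleton, Submodule.mem_bot] at h
      have : m = 0 := hx (by simpa using h)
      subst this
      exact hpp.ne_top (hm.trans (by ext; simp))
    let N : Submodule A M := Submodule.torsionBySet A M p
    have hN : ¬ N ≤ x • (⊤ : Submodule A M) := by
      intro hle
      have : N = ⊥ := by
        refine Submodule.eq_bot_of_le_smul_of_le_jacobson_bot (Ideal.span {x}) N
          (IsNoetherian.noetherian N) ?_ ?_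
        · intro y hy
          obtain ⟨z, -, rfl⟩ := (Submodule.mem_smul_pointwise_iff_exists _ _ _).mp (hle hy)
          rw [Submodule.ideal_span_singleton_smul]
          refine Submodule.smul_mem_pointwise_smul _ _ _ ?_
          rw [Submodule.mem_torsionBySet_iff] at hy ⊢
          intro a
          apply hx
          have := hy a
          simp only [smul_zero]
          rw [smul_comm]; exact this
        · rw [Ideal.span_singleton_le_iff_mem]
          exact maximalIdeal_le_jacobson _ hxm
      have hmN : m ∈ N := by
        rw [Submodule.mem_torsionBySet_iff]
        rintro ⟨a, ha⟩
        rw [SetLike.mem_coe, hm, Submodule.mem_colon_singleton, Submodule.mem_bot] at ha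
        exact ha
      rw [this, Submodule.mem_bot] at hmN
      exact hpp.ne_top (hm.trans (by subst hmN; ext; simp))
    obtain ⟨y, hyN, hy⟩ := SetLike.not_le_iff_exists.mp hN
    have hy0 : (Submodule.Quotient.mk y : QuotSMulTop x M) ≠ 0 := by
      rwa [Ne, Submodule.Quotient.mk_eq_zero]
    obtain ⟨q, hq, hle⟩ := exists_le_isAssociatedPrime_of_isNoetherianRing A _ hy0
    have hqp := hq.isPrime
    have hpq : p ≤ q := by
      refine le_trans ?_ hle
      intro a ha
      rw [Submodule.mem_colon_singleton, Submodule.mem_bot, ← Submodule.Quotient.mk_smul]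
      rw [Submodule.mem_torsionBySet_iff] at hyN
      have : a • y = 0 := hyN ⟨a, ha⟩
      rw [this, Submodule.Quotient.mk_zero]
    have hxq : x ∈ q := by
      refine hle ?_
      rw [Submodule.mem_colon_singleton, Submodule.mem_bot, ← Submodule.Quotient.mk_smul,
        Submodule.Quotient.mk_eq_zero]
      exact Submodule.smul_mem_pointwise_smul _ _ _ trivial
    have h1 := ih (QuotSMulTop x M) q hq (fun r hr => hrs r (by simp [hr])) hreg
    have h2 := ringKrullDim_succ_le_of_surjective (Ideal.Quotient.factor hpq)
      (Ideal.Quotient.factor_surjective hpq) (r := Ideal.Quotient.mk p x)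
      (mem_nonZeroDivisors_of_ne_zero (by rwa [Ne, Ideal.Quotient.eq_zero_iff_mem]))
      (by simpa [Ideal.Quotient.eq_zero_iff_mem] using hxq)
    refine le_trans ?_ h2
    simp only [List.length_cons, Nat.cast_add, Nat.cast_one]
    gcongr

theorem exists_nat_eq_of_add_le {x : WithBot ℕ∞} {m d : ℕ} (h0 : 0 ≤ x) (h : x + m ≤ d) :
    ∃ k : ℕ, x = k := by
  induction x using WithBot.recBotCoe with
  | bot => simp at h0
  | coe x =>
    induction x using ENat.recTopCoe with
    | top =>
      have : ((⊤ + (m : ℕ∞) : ℕ∞) : WithBot ℕ∞) ≤ ((d : ℕ∞) : WithBot ℕ∞) := h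
      rw [WithBot.coe_le_coe, top_add] at this
      exact absurd this (by simp)
    | coe k => exact ⟨k, rfl⟩

open IsLocalRing in
theorem ringKrullDim_quotient_le_add_length {A : Type} [CommRing A] [IsLocalRing A]
    [IsNoetherianRing A] (q : Ideal A) (hq : q ≠ ⊤) (fs : List A)
    (hfs : ∀ f ∈ fs, f ∈ maximalIdeal A) :
    ringKrullDim (A ⧸ q) ≤ ringKrullDim (A ⧸ (q ⊔ Ideal.ofList fs)) + fs.length := by
  classical
  have : Nontrivial (A ⧸ q) := Ideal.Quotient.nontrivial_iff.mpr hq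
  have : IsLocalRing (A ⧸ q) :=
    IsLocalRing.of_surjective' (Ideal.Quotient.mk q) Ideal.Quotient.mk_surjective
  let s : Finset (A ⧸ q) := (fs.map (Ideal.Quotient.mk q)).toFinset
  have hs : (s : Set (A ⧸ q)) ⊆ Ring.jacobson (A ⧸ q) := by
    rw [IsLocalRing.ringJacobson_eq_maximalIdeal]
    intro x hx
    simp only [s, List.coe_toFinset, List.mem_map, Set.mem_ofPred_eq] at hx
    obtain ⟨f, hf, rfl⟩ := hx
    have := IsLocalHom.of_surjective (Ideal.Quotient.mk q) Ideal.Quotient.mk_surjective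
    rw [SetLike.mem_coe, IsLocalRing.mem_maximalIdeal, mem_nonunits_iff]
    exact fun hu => hfs f hf ((isUnit_map_iff (Ideal.Quotient.mk q) f).mp hu)
  have h := ringKrullDim_le_ringKrullDim_quotient_add_card s hs
  have hcard : s.card ≤ fs.length := (List.toFinset_card_le _).trans (by simp)
  have hmap : Ideal.span (s : Set (A ⧸ q)) = (Ideal.ofList fs).map (Ideal.Quotient.mk q) := by
    rw [Ideal.map_ofList]
    congr 1
    ext; simp [s]
  rw [hmap] at h
  rw [← ringKrullDim_eq_of_ringEquiv (DoubleQuot.quotQuotEquivQuotSup q (Ideal.ofList fs))]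
  refine h.trans ?_
  gcongr

open Pointwise IsLocalRing RingTheory.Sequence in
/-- If `fs` cuts down the dimension as much as possible, every associated prime of the quotient of
a module of depth at least `d` by `fs` has dimension at least `d - fs.length`. -/
theorem le_ringKrullDim_quotient_add_length {A : Type} [CommRing A]
    [IsLocalRing A] [IsNoetherianRing A] (fs : List A) :
    ∀ (M : Type) [AddCommGroup M] [Module A M] [Module.Finite A M] (I : Ideal A) (d : ℕ),
      I ≤ Module.annihilator A M →
      (∃ rs : List A, rs.length = d ∧ (∀ r ∈ rs, r ∈ maximalIdeal A) ∧ IsRegular M rs) →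
      (∀ f ∈ fs, f ∈ maximalIdeal A) →
      ringKrullDim (A ⧸ (I ⊔ Ideal.ofList fs)) + fs.length ≤ d →
      ∀ p ∈ associatedPrimes A (M ⧸ (Ideal.ofList fs • ⊤ : Submodule A M)),
        (d : WithBot ℕ∞) ≤ ringKrullDim (A ⧸ p) + fs.length := by
  induction fs with
  | nil =>
    rintro M _ _ _ I d hI ⟨rs, rfl, hrs, hreg⟩ - - p hp
    have e : (M ⧸ (Ideal.ofList ([] : List A) • ⊤ : Submodule A M)) ≃ₗ[A] M :=
      Submodule.quotEquivOfEqBot _ (by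
        rw [Ideal.ofList_nil]; exact Submodule.bot_smul _)
    rw [LinearEquiv.AssociatedPrimes.eq e] at hp
    simpa using length_le_ringKrullDim_quotient_of_mem_associatedPrimes rs M p hp hrs hreg.1
  | cons f fs ih =>
    intro M _ _ _ I d hI hdepth hfs hdim p hp
    have hM : Nontrivial M := hdepth.choose_spec.2.2.nontrivial
    have hfm := hfs f (by simp)
    have hfs' : ∀ r ∈ fs, r ∈ maximalIdeal A := fun r hr => hfs r (by simp [hr])
    have h0 : (0 : WithBot ℕ∞) ≤ ringKrullDim (A ⧸ (I ⊔ Ideal.ofList (f :: fs))) := by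
      have : I ⊔ Ideal.ofList (f :: fs) ≤ maximalIdeal A := by
        refine sup_le (IsLocalRing.le_maximalIdeal fun htop => ?_) (Ideal.span_le.mpr hfs)
        rw [htop] at hI
        have : Subsingleton M := Module.annihilator_eq_top_iff.mp (top_le_iff.mp hI)
        exact not_subsingleton M this
      have : Nontrivial (A ⧸ (I ⊔ Ideal.ofList (f :: fs))) :=
        Ideal.Quotient.nontrivial_iff.mpr
          (ne_top_of_le_ne_top (maximalIdeal.isMaximal A).ne_top this)
      exact ringKrullDim_nonneg_of_nontrivial
    obtain ⟨k, hk⟩ := exists_nat_eq_of_add_le h0 hdim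
    have hreg : IsSMulRegular M f := by
      by_contra hnr
      have : f ∈ ⋃ q ∈ associatedPrimes A M, (q : Set A) := by
        rw [biUnion_associatedPrimes_eq_compl_regular]
        exact hnr
      simp only [Set.mem_iUnion, SetLike.mem_coe] at this
      obtain ⟨q, hq, hfq⟩ := this
      have hqp := hq.isPrime
      obtain ⟨rs, hlen, hrs, hreg⟩ := hdepth
      have h1 := length_le_ringKrullDim_quotient_of_mem_associatedPrimes rs M q hq hrs hreg.1
      have hIq : I ≤ q := by
        refine hI.trans ?_
        rw [← Submodule.annihilator_top]
        exact hq.annihilator_le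
      have h2 := ringKrullDim_quotient_le_add_length q hqp.ne_top fs hfs'
      have h3 : ringKrullDim (A ⧸ (q ⊔ Ideal.ofList fs)) ≤
          ringKrullDim (A ⧸ (I ⊔ Ideal.ofList (f :: fs))) := by
        have : I ⊔ Ideal.ofList (f :: fs) ≤ q ⊔ Ideal.ofList fs := by
          rw [Ideal.ofList_cons]
          refine sup_le (hIq.trans le_sup_left) (sup_le ?_ le_sup_right)
          exact ((Ideal.span_singleton_le_iff_mem _).mpr hfq).trans le_sup_left
        exact ringKrullDim_le_of_surjective _ (Ideal.Quotient.factor_surjective this)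
      have h4 : (rs.length : WithBot ℕ∞) ≤
          ringKrullDim (A ⧸ (I ⊔ Ideal.ofList (f :: fs))) + fs.length :=
        h1.trans (h2.trans (by gcongr))
      rw [hlen] at h4
      rw [hk] at h4 hdim
      simp only [List.length_cons] at hdim
      norm_cast at h4 hdim
      omega
    obtain ⟨d, rfl⟩ : ∃ e, d = e + 1 := by
      rcases d with _ | d
      · rw [hk] at hdim
        simp only [List.length_cons] at hdim
        norm_cast at hdim
      · exact ⟨d, rfl⟩
    have hQ := exists_isRegular_quotSMulTop hfm hreg hdepth
    rw [LinearEquiv.AssociatedPrimes.eq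
      (Submodule.quotOfListConsSMulTopEquivQuotSMulTopInner M f fs)] at hp
    have := ih (QuotSMulTop f M) (I ⊔ Ideal.span {f}) d ?_ hQ hfs' ?_ p hp
    · simp only [List.length_cons]
      push_cast
      rw [← add_assoc]
      gcongr
    · refine sup_le (hI.trans ?_) ?_
      · exact (Submodule.mkQ (f • (⊤ : Submodule A M))).annihilator_le_of_surjective
          (Submodule.mkQ_surjective _)
      · rw [Ideal.span_singleton_le_iff_mem, Module.mem_annihilator]
        intro m
        obtain ⟨m, rfl⟩ := Submodule.Quotient.mk_surjective _ m
        rw [← Submodule.Quotient.mk_smul, Submodule.Quotient.mk_eq_zero]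
        exact Submodule.smul_mem_pointwise_smul _ _ _ trivial
    · rw [Ideal.ofList_cons, ← sup_assoc] at hk hdim
      rw [hk] at hdim ⊢
      simp only [List.length_cons] at hdim
      norm_cast at hdim ⊢
      omega

theorem krullDim_le_of_strictAnti_nat {α : Type*} [PartialOrder α] (g : α → ℕ) (hg : StrictAnti g)
    (b : ℕ) (hb : ∀ x, g x ≤ b) : Order.krullDim α ≤ b := by
  refine iSup_le fun s => ?_
  have key : ∀ i : Fin (s.length + 1), (i : ℕ) + g (s i) ≤ g (s 0) := by
    intro i
    induction i using Fin.induction with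
    | zero => simp
    | succ i ih =>
      have := hg (s.step i)
      simp only [Fin.val_succ, Fin.val_castSucc] at ih ⊢
      omega
  have h1 := key (Fin.last _)
  have h2 := hb (s 0)
  simp only [Fin.val_last] at h1
  exact_mod_cast (by omega : s.length ≤ b)

theorem ringKrullDim_quotient_le_of_trdeg_le {k R : Type} [Field k] [CommRing R] [Algebra k R]
    [Algebra.FiniteType k R] (I : Ideal R) (b : ℕ)
    (h : ∀ P : Ideal R, P.IsPrime → I ≤ P → Algebra.trdeg k (R ⧸ P) ≤ b) :
    ringKrullDim (R ⧸ I) ≤ b := by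
  let c : PrimeSpectrum (R ⧸ I) → PrimeSpectrum R := PrimeSpectrum.comap (Ideal.Quotient.mk I)
  have hI : ∀ x, I ≤ (c x).asIdeal := fun x a ha => by
    change Ideal.Quotient.mk I a ∈ x.asIdeal
    rw [Ideal.Quotient.eq_zero_iff_mem.mpr ha]
    exact zero_mem _
  have hlt : ∀ x, Algebra.trdeg k (R ⧸ (c x).asIdeal) ≤ b := fun x => h _ (c x).2 (hI x)
  have hfin : ∀ x, Algebra.trdeg k (R ⧸ (c x).asIdeal) < Cardinal.aleph0 := fun x =>
    (hlt x).trans_lt (Cardinal.natCast_lt_aleph0)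
  refine krullDim_le_of_strictAnti_nat
    (fun x => Cardinal.toNat (Algebra.trdeg k (R ⧸ (c x).asIdeal))) ?_ b ?_
  · intro x y hxy
    have hcxy : (c x).asIdeal < (c y).asIdeal := by
      refine lt_of_le_of_ne (fun a ha => hxy.le ha) fun he => hxy.ne ?_
      exact PrimeSpectrum.comap_injective_of_surjective _ Ideal.Quotient.mk_surjective
        (PrimeSpectrum.ext he)
    refine Cardinal.toNat_lt_toNat ?_ (hfin x)
    refine trdeg_lt_of_surjective_of_not_injective (Ideal.Quotient.factorₐ k hcxy.le)
      (Ideal.Quotient.factor_surjective hcxy.le) fun hinj => hcxy.not_ge fun a ha => ?_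
    have : Ideal.Quotient.factorₐ k hcxy.le (Ideal.Quotient.mk _ a) = 0 :=
      Ideal.Quotient.eq_zero_iff_mem.mpr ha
    exact Ideal.Quotient.eq_zero_iff_mem.mp (hinj (this.trans (map_zero _).symm))
  · intro x
    have := Cardinal.toNat_le_toNat (hlt x) Cardinal.natCast_lt_aleph0
    simpa using this

theorem ringKrullDim_quotient_map_le_of_isLocalization {R A : Type} [CommRing R] [CommRing A]
    [Algebra R A] (M : Submonoid R) [IsLocalization M A] (I : Ideal R) :
    ringKrullDim (A ⧸ I.map (algebraMap R A)) ≤ ringKrullDim (R ⧸ I) := by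
  let φ : R ⧸ I →+* A ⧸ I.map (algebraMap R A) :=
    Ideal.quotientMap _ (algebraMap R A) Ideal.le_comap_map
  have hinj : Function.Injective (PrimeSpectrum.comap φ) := by
    have h1 : Function.Injective ((PrimeSpectrum.comap (algebraMap R A)) ∘
        (PrimeSpectrum.comap (Ideal.Quotient.mk (I.map (algebraMap R A))))) :=
      (PrimeSpectrum.localization_comap_injective A M).comp
        (PrimeSpectrum.comap_injective_of_surjective _ Ideal.Quotient.mk_surjective)
    refine Function.Injective.of_comp (f := PrimeSpectrum.comap (Ideal.Quotient.mk I)) ?_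
    exact h1
  have hmono : Monotone (PrimeSpectrum.comap φ) := fun x y hxy a ha => hxy ha
  exact Order.krullDim_le_of_strictMono _ (hmono.strictMono_of_injective hinj)

open MvPolynomial RingTheory.Sequence in
theorem MvPolynomial.isWeaklyRegular_map_X {σ k : Type} [Field k] (l : List σ) (hl : l.Nodup) :
    IsWeaklyRegular (MvPolynomial σ k) (l.map (X : σ → MvPolynomial σ k)) := by
  classical
  rw [isWeaklyRegular_iff_Fin]
  intro i
  have hi : (i : ℕ) < l.length := by simpa using i.2
  have hspan : (Ideal.ofList ((l.map (X : σ → MvPolynomial σ k)).take i) • ⊤ :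
      Submodule (MvPolynomial σ k) (MvPolynomial σ k)) =
      Ideal.span (X '' {s | s ∈ l.take i}) := by
    rw [smul_eq_mul, Ideal.mul_top, Ideal.ofList, ← List.map_take]
    exact congrArg Ideal.span (Set.ext fun _ => List.mem_map)
  have hnot : l[(i : ℕ)] ∉ l.take i := by
    intro hmem
    obtain ⟨j, hj, he⟩ := List.mem_take_iff_getElem.mp hmem
    have := (List.Nodup.getElem_inj_iff hl).mp he
    omega
  rw [hspan]
  rw [isSMulRegular_iff_right_eq_zero_of_smul]
  intro x hx
  obtain ⟨p, rfl⟩ := Submodule.Quotient.mk_surjective _ x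
  rw [← Submodule.Quotient.mk_smul, Submodule.Quotient.mk_eq_zero] at hx
  rw [Submodule.Quotient.mk_eq_zero]
  have hget : (l.map (X : σ → MvPolynomial σ k))[i] = X l[(i : ℕ)] := by simp
  rw [hget, smul_eq_mul, mem_ideal_span_X_image] at hx
  rw [mem_ideal_span_X_image]
  intro m hm
  obtain ⟨s, hs, hne⟩ := hx (Finsupp.single l[(i : ℕ)] 1 + m) (by
    rw [mem_support_iff, coeff_X_mul]; exact mem_support_iff.mp hm)
  refine ⟨s, hs, ?_⟩
  have : s ≠ l[(i : ℕ)] := fun h => hnot (h ▸ hs)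
  rw [Finsupp.add_apply, Finsupp.single_eq_of_ne this, zero_add] at hne
  exact hne

open MvPolynomial RingTheory.Sequence in
theorem MvPolynomial.exists_isWeaklyRegular_mem_isMaximal {σ k : Type} [Fintype σ] [Field k]
    [IsAlgClosed k] (𝔪 : Ideal (MvPolynomial σ k)) (h𝔪 : 𝔪.IsMaximal) :
    ∃ rs : List (MvPolynomial σ k), rs.length = Fintype.card σ ∧ (∀ r ∈ rs, r ∈ 𝔪) ∧
      IsWeaklyRegular (MvPolynomial σ k) rs := by
  obtain ⟨a, rfl⟩ := (isMaximal_iff_eq_vanishingIdeal_singleton (K := k)).mp h𝔪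
  have hreg := isWeaklyRegular_map_X (k := k) (Finset.univ : Finset σ).toList
    (Finset.nodup_toList _)
  let f : MvPolynomial σ k →ₐ[k] MvPolynomial σ k := aeval fun i => X i - C (a i)
  let g : MvPolynomial σ k →ₐ[k] MvPolynomial σ k := aeval fun i => X i + C (a i)
  have hfg : f.comp g = AlgHom.id k _ := by
    ext i : 1
    simp [f, g]
  have hgf : g.comp f = AlgHom.id k _ := by
    ext i : 1
    simp [f, g]
  let e : MvPolynomial σ k ≃ₐ[k] MvPolynomial σ k := AlgEquiv.ofAlgHom f g hfg hgf
  refine ⟨(Finset.univ : Finset σ).toList.map fun i => X i - C (a i), by simp, ?_, ?_⟩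
  · intro r hr
    obtain ⟨i, -, rfl⟩ := List.mem_map.mp hr
    rw [mem_vanishingIdeal_iff]
    rintro x rfl
    simp
  · refine (AddEquiv.isWeaklyRegular_congr (e := e.toAddEquiv) ?_).mp hreg
    rw [List.forall₂_map_left_iff, List.forall₂_map_right_iff, List.forall₂_same]
    intro i _ x
    change f (X i • x) = _ • f x
    simp [f]

open MvPolynomial RingTheory.Sequence in
/-- Macaulay's unmixedness theorem for polynomial rings over an algebraically closed field. -/
theorem MvPolynomial.card_le_ringKrullDim_quotient_add_length {σ k : Type} [Fintype σ] [Field k]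
    [IsAlgClosed k] (fs : List (MvPolynomial σ k))
    (hdim : ringKrullDim (MvPolynomial σ k ⧸ Ideal.ofList fs) + fs.length ≤ Fintype.card σ)
    (P : Ideal (MvPolynomial σ k)) (hP : P.IsPrime) (b : MvPolynomial σ k)
    (hb : ∀ x, x ∈ P ↔ x * b ∈ Ideal.ofList fs) :
    (Fintype.card σ : WithBot ℕ∞) ≤ ringKrullDim (MvPolynomial σ k ⧸ P) + fs.length := by
  obtain ⟨𝔪, h𝔪, hP𝔪⟩ := P.exists_le_maximal hP.ne_top
  obtain ⟨rs, hlen, hrs, hreg⟩ := exists_isWeaklyRegular_mem_isMaximal 𝔪 h𝔪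
  let R := MvPolynomial σ k
  let A := Localization.AtPrime 𝔪
  let J := Ideal.ofList fs
  have hJP : J ≤ P := fun x hx => (hb x).mpr (Ideal.mul_mem_right _ _ hx)
  have hmem : ∀ r ∈ 𝔪, algebraMap R A r ∈ IsLocalRing.maximalIdeal A := fun r hr =>
    (IsLocalization.AtPrime.to_map_mem_maximal_iff A 𝔪 r).mpr hr
  have hregA := hreg.isRegular_of_isLocalization_of_mem A 𝔪 hrs
  let fs' : List A := fs.map (algebraMap R A)
  have hJ' : J.map (algebraMap R A) = Ideal.ofList fs' := Ideal.map_ofList _ _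
  have hdisj : Disjoint (𝔪.primeCompl : Set R) (P : Set R) :=
    Set.disjoint_left.mpr fun x hx hxP => hx (hP𝔪 hxP)
  let p := P.map (algebraMap R A)
  have hp : p.IsPrime := IsLocalization.isPrime_of_isPrime_disjoint 𝔪.primeCompl A P hP hdisj
  have hass : p ∈ associatedPrimes A (A ⧸ (Ideal.ofList fs' • ⊤ : Submodule A A)) := by
    refine Submodule.isAssociatedPrime_iff.mpr ⟨hp, Submodule.Quotient.mk (algebraMap R A b), ?_⟩
    ext x
    rw [Submodule.mem_colon_singleton, Submodule.mem_bot, ← Submodule.Quotient.mk_smul,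
      Submodule.Quotient.mk_eq_zero, smul_eq_mul, smul_eq_mul, Ideal.mul_top, ← hJ']
    obtain ⟨a, s, rfl⟩ := IsLocalization.exists_mk'_eq 𝔪.primeCompl x
    have hx : ∀ y : A, IsLocalization.mk' A a s * y =
      IsLocalization.mk' A 1 s * (algebraMap R A a * y) := fun y => by
        rw [← mul_assoc, ← IsLocalization.mk'_one (M := 𝔪.primeCompl) A a,
          ← IsLocalization.mk'_mul]; simp
    have hu : IsUnit (IsLocalization.mk' A 1 s) := by
      refine IsUnit.of_mul_eq_one (algebraMap R A s) ?_
      rw [IsLocalization.mk'_spec, map_one]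
    have h1 := hx 1
    rw [mul_one, mul_one] at h1
    rw [hx, h1, Ideal.unit_mul_mem_iff_mem _ hu, Ideal.unit_mul_mem_iff_mem _ hu, ← map_mul]
    rw [IsLocalization.algebraMap_mem_map_algebraMap_iff 𝔪.primeCompl,
      IsLocalization.algebraMap_mem_map_algebraMap_iff 𝔪.primeCompl]
    constructor
    · rintro ⟨m, hm, h⟩
      exact ⟨m, hm, by rw [← mul_assoc]; exact (hb _).mp h⟩
    · rintro ⟨m, hm, h⟩
      exact ⟨m, hm, (hb _).mpr (by rw [mul_assoc]; exact h)⟩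
  have hfs' : ∀ f ∈ fs', f ∈ IsLocalRing.maximalIdeal A := by
    intro f hf
    obtain ⟨g, hg, rfl⟩ := List.mem_map.mp hf
    exact hmem g (hP𝔪 (hJP (Ideal.subset_span hg)))
  have hdim' : ringKrullDim (A ⧸ (⊥ ⊔ Ideal.ofList fs')) + fs'.length ≤ (Fintype.card σ : ℕ) := by
    rw [bot_sup_eq, ← hJ', List.length_map]
    refine le_trans ?_ hdim
    gcongr
    exact ringKrullDim_quotient_map_le_of_isLocalization 𝔪.primeCompl J
  have := le_ringKrullDim_quotient_add_length fs' A ⊥ (Fintype.card σ) bot_le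
    ⟨_, (List.length_map _).trans hlen, by
      intro r hr
      obtain ⟨g, hg, rfl⟩ := List.mem_map.mp hr
      exact hmem g (hrs g hg), hregA⟩ hfs' hdim' p hass
  rw [List.length_map] at this
  refine this.trans ?_
  gcongr
  exact ringKrullDim_quotient_map_le_of_isLocalization 𝔪.primeCompl P

theorem mul_apply_mem_upperLowerIdeal {n : ℕ} {i j : Fin n} (h : i < j) :
    (Xgen n * Ygen n) i j ∈ upperLowerIdeal n :=
  Ideal.subset_span (Or.inl ⟨i, j, h, rfl⟩)

theorem mul_apply_mem_upperLowerIdeal' {n : ℕ} {i j : Fin n} (h : j < i) :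
    (Ygen n * Xgen n) i j ∈ upperLowerIdeal n :=
  Ideal.subset_span (Or.inr ⟨i, j, h, rfl⟩)

theorem exists_list_ofList_eq_upperLowerIdeal (n : ℕ) :
    ∃ fs : List (PolyRing n), fs.length = n * n - n ∧ Ideal.ofList fs = upperLowerIdeal n := by
  refine ⟨(Finset.univ : Finset (Fin n)).offDiag.toList.map fun p =>
    if p.1 < p.2 then (Xgen n * Ygen n) p.1 p.2 else (Ygen n * Xgen n) p.1 p.2, ?_, ?_⟩
  · simp [Finset.offDiag_card]
  · apply le_antisymm
    · refine Ideal.span_le.mpr fun f hf => ?_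
      obtain ⟨p, hp, rfl⟩ := List.mem_map.mp hf
      have hne : p.1 ≠ p.2 := (Finset.mem_offDiag.mp (Finset.mem_toList.mp hp)).2.2
      split_ifs with h
      · exact mul_apply_mem_upperLowerIdeal h
      · exact mul_apply_mem_upperLowerIdeal' (lt_of_le_of_ne (not_lt.mp h) hne.symm)
    · refine Ideal.span_le.mpr ?_
      rintro f (⟨i, j, h, rfl⟩ | ⟨i, j, h, rfl⟩)
      · refine Ideal.subset_span (List.mem_map.mpr ⟨(i, j), ?_, by simp [h]⟩)
        simp [h.ne]
      · refine Ideal.subset_span (List.mem_map.mpr ⟨(i, j), ?_, by simp [h.not_gt]⟩)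
        simp [h.ne']

open Classical in
theorem trdeg_quotient_le_of_upperLowerIdeal_le {n : ℕ} (P : Ideal (PolyRing n)) (hP : P.IsPrime)
    (hle : upperLowerIdeal n ≤ P) :
    Algebra.trdeg ℂ (PolyRing n ⧸ P) ≤ ((n * n + (Finset.univ.image fun i =>
      Ideal.Quotient.mk P ((Xgen n * Ygen n) i i)).card : ℕ) : Cardinal) := by
  let q : PolyRing n →ₐ[ℂ] PolyRing n ⧸ P := Ideal.Quotient.mkₐ ℂ P
  have hXY : (Xgen n).map q * (Ygen n).map q = (Xgen n * Ygen n).map q := by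
    rw [Matrix.map_mul]
  have hYX : (Ygen n).map q * (Xgen n).map q = (Ygen n * Xgen n).map q := by
    rw [Matrix.map_mul]
  have h := trdeg_le_of_triangular (k := ℂ) ((Xgen n).map q) ((Ygen n).map q)
    (fun i j hij => by
      rw [hXY]
      exact Ideal.Quotient.eq_zero_iff_mem.mpr (hle (mul_apply_mem_upperLowerIdeal hij)))
    (fun i j hij => by
      rw [hYX]
      exact Ideal.Quotient.eq_zero_iff_mem.mpr (hle (mul_apply_mem_upperLowerIdeal' hij)))
    (fun B hX hY => by
      rw [eq_top_iff]
      intro x _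
      obtain ⟨p, rfl⟩ := Ideal.Quotient.mk_surjective x
      have : B.comap q = ⊤ := by
        rw [eq_top_iff, ← MvPolynomial.adjoin_range_X, Algebra.adjoin_le_iff]
        rintro _ ⟨⟨i, j⟩ | ⟨i, j⟩, rfl⟩
        · exact hX i j
        · exact hY i j
      have hp : p ∈ B.comap q := this ▸ trivial
      exact hp)
  rw [hXY] at h
  exact h

theorem diag_sub_diag_notMem_of_mem_iff {n : ℕ} (P : Ideal (PolyRing n)) (hP : P.IsPrime)
    (b : PolyRing n) (hb : ∀ x, x ∈ P ↔ x * b ∈ upperLowerIdeal n) {i j : Fin n} (hij : i ≠ j) :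
    (Xgen n * Ygen n) i i - (Xgen n * Ygen n) j j ∉ P := by
  classical
  intro hmem
  obtain ⟨fs, hlen, hfs⟩ := exists_list_ofList_eq_upperLowerIdeal n
  have hn : n ≤ n * n := Nat.le_mul_self n
  have hcard : Fintype.card ((Fin n × Fin n) ⊕ (Fin n × Fin n)) = n * n + n * n := by simp
  have hJP : upperLowerIdeal n ≤ P := fun x hx => (hb x).mpr (Ideal.mul_mem_right _ _ hx)
  have hJ : ringKrullDim (PolyRing n ⧸ upperLowerIdeal n) ≤ (n * n + n : ℕ) := by
    refine ringKrullDim_quotient_le_of_trdeg_le (k := ℂ) _ _ fun Q hQ hle => ?_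
    refine (trdeg_quotient_le_of_upperLowerIdeal_le Q hQ hle).trans ?_
    have := Finset.card_image_le (s := (Finset.univ : Finset (Fin n)))
      (f := fun i => Ideal.Quotient.mk Q ((Xgen n * Ygen n) i i))
    rw [Finset.card_univ, Fintype.card_fin] at this
    exact_mod_cast Nat.add_le_add_left this _
  have hPdim : ringKrullDim (PolyRing n ⧸ P) ≤ (n * n + (n - 1) : ℕ) := by
    refine ringKrullDim_quotient_le_of_trdeg_le (k := ℂ) _ _ fun Q hQ hle => ?_
    refine (trdeg_quotient_le_of_upperLowerIdeal_le Q hQ (hJP.trans hle)).trans ?_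
    have : (Finset.univ.image fun i => Ideal.Quotient.mk Q ((Xgen n * Ygen n) i i)) ⊆
        (Finset.univ.erase i).image fun i => Ideal.Quotient.mk Q ((Xgen n * Ygen n) i i) := by
      intro x hx
      obtain ⟨l, -, rfl⟩ := Finset.mem_image.mp hx
      by_cases hl : l = i
      · subst hl
        refine Finset.mem_image.mpr ⟨j, by simp [hij.symm], ?_⟩
        exact (Ideal.Quotient.eq.mpr (hle hmem)).symm
      · exact Finset.mem_image.mpr ⟨l, by simp [hl], rfl⟩
    have h2 := (Finset.card_le_card this).trans Finset.card_image_le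
    rw [Finset.card_erase_of_mem (Finset.mem_univ i), Finset.card_univ, Fintype.card_fin] at h2
    exact_mod_cast Nat.add_le_add_left h2 _
  have h := MvPolynomial.card_le_ringKrullDim_quotient_add_length fs (by
    rw [hfs, hlen, hcard]
    refine (add_le_add_left hJ _).trans ?_
    exact_mod_cast (by omega : n * n + n + (n * n - n) ≤ n * n + n * n)) P hP b (by rwa [hfs])
  rw [hlen, hcard] at h
  have h2 := h.trans (add_le_add_left hPdim _)
  have h3 : n * n + n * n ≤ n * n + (n - 1) + (n * n - n) := by exact_mod_cast h2
  have := i.pos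
  omega

open Matrix in
theorem Matrix.BlockTriangular.adjugate_of_det_eq_one {ι α A : Type*} [Fintype ι] [DecidableEq ι]
    [LinearOrder α] [CommRing A] {b : ι → α} {M : Matrix ι ι A} (hM : M.BlockTriangular b)
    (hdet : M.det = 1) : M.adjugate.BlockTriangular b := by
  have : Invertible M := M.invertibleOfIsUnitDet (by simp [hdet])
  have h := blockTriangular_inv_of_blockTriangular hM
  rwa [inv_def, hdet, Ring.inverse_one, one_smul] at h

open Matrix in
/-- A triangular matrix whose diagonal entries have invertible differences is conjugate to a
diagonal matrix by a unipotent triangular matrix. -/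
theorem Matrix.BlockTriangular.exists_mul_eq_mul_diagonal {ι α A : Type*} [Fintype ι]
    [DecidableEq ι] [LinearOrder α] [CommRing A] {b : ι → α} (hb : Function.Injective b)
    (hdet : ∀ M : Matrix ι ι A, M.BlockTriangular b → M.det = ∏ i, M i i)
    {L : Matrix ι ι A} (hL : L.BlockTriangular b)
    (hunit : ∀ i j, i ≠ j → IsUnit (L i i - L j j)) :
    ∃ B : Matrix ι ι A, B.BlockTriangular b ∧ (∀ i, B i i = 1) ∧
      L * B = B * diagonal fun i => L i i := by
  have key : ∀ j, ∃ v : ι → A, (∀ i, b j < b i → v i = 0) ∧ v j = 1 ∧ L *ᵥ v = L j j • v := by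
    intro j
    let N : Matrix ι ι A := L - L j j • 1 + diagonal (Pi.single j 1)
    have hN : N.BlockTriangular b := by
      refine (hL.sub ?_).add (blockTriangular_diagonal _)
      rw [smul_one_eq_diagonal]
      exact blockTriangular_diagonal _
    have hNii : ∀ i, N i i = if i = j then 1 else L i i - L j j := by
      intro i
      by_cases h : i = j
      · subst h; simp [N]
      · simp [N, h]
    have hNu : IsUnit N.det := by
      rw [hdet N hN, IsUnit.prod_univ_iff]
      intro i
      rw [hNii]
      split_ifs with h
      · exact isUnit_one
      · exact hunit i j h
    have : Invertible N := N.invertibleOfIsUnitDet hNu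
    have hinv := blockTriangular_inv_of_blockTriangular hN
    let v : ι → A := N⁻¹ *ᵥ Pi.single j 1
    have hv : ∀ i, v i = N⁻¹ i j := fun i => by simp [v]
    have hNv : N *ᵥ v = Pi.single j 1 := by
      simp only [v]
      rw [mulVec_mulVec, mul_nonsing_inv _ hNu, one_mulVec]
    have hv0 : ∀ i, b j < b i → v i = 0 := fun i hij => by
      rw [hv]; exact hinv hij
    have hvj : v j = 1 := by
      have h := congrFun hNv j
      rw [mulVec, dotProduct, Finset.sum_eq_single j] at h
      · rw [hNii] at h; simpa using h
      · intro k _ hk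
        rcases lt_or_gt_of_ne (fun h => hk (hb h) : b k ≠ b j) with h | h
        · rw [hN h, zero_mul]
        · rw [hv0 k h, mul_zero]
      · simp
    refine ⟨v, hv0, hvj, ?_⟩
    have h2 : diagonal (Pi.single j (1 : A)) *ᵥ v = Pi.single j 1 := by
      ext i
      rw [mulVec_diagonal]
      by_cases h : i = j
      · subst h; simp [hvj]
      · simp [h]
    simp only [N] at hNv
    rw [add_mulVec, h2, sub_mulVec, smul_mulVec, one_mulVec] at hNv
    exact sub_eq_zero.mp (add_eq_right.mp hNv)
  choose v hv0 hv1 hv using key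
  refine ⟨Matrix.of fun i j => v j i, fun i j hij => hv0 j i hij, hv1, ?_⟩
  ext i j
  rw [mul_diagonal]
  have := congrFun (hv j) i
  rw [Pi.smul_apply, smul_eq_mul, mul_comm] at this
  exact this

theorem det_eq_one_of_diag_eq_one {n : ℕ} {A : Type*} [CommRing A] {B : Matrix (Fin n) (Fin n) A}
    (hdet : B.det = ∏ i, B i i) (h : ∀ i, B i i = 1) : B.det = 1 := by
  simp [hdet, h]

open Matrix in
/-- Over a field, the diagonals of `X * Y` and `Y * X` agree up to permutation if these matrices
are triangular. -/
theorem injective_diag_mul_comm {n : ℕ} {k : Type*} [Field k] (X Y : Matrix (Fin n) (Fin n) k)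
    (hXY : (X * Y).BlockTriangular OrderDual.toDual) (hYX : (Y * X).BlockTriangular id)
    (hinj : Function.Injective fun i => (X * Y) i i) :
    Function.Injective fun i => (Y * X) i i := by
  have h1 : (Y * X).charpoly = ∏ i, (Polynomial.X - Polynomial.C ((Y * X) i i)) :=
    charpoly_of_isUpperTriangular _ hYX
  have h2 : (X * Y).charpoly = ∏ i, (Polynomial.X - Polynomial.C ((X * Y) i i)) := by
    rw [← charpoly_transpose]
    exact charpoly_of_isUpperTriangular _ hXY.transpose
  rw [charpoly_mul_comm, h1] at h2
  have h3 := congrArg Polynomial.roots h2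
  have hroots : ∀ f : Fin n → k, (∏ i, (Polynomial.X - Polynomial.C (f i))).roots =
      Finset.univ.val.map f := fun f => by
    rw [← Polynomial.roots_multiset_prod_X_sub_C (Finset.univ.val.map f), Multiset.map_map]
    rfl
  rw [hroots, hroots] at h3
  have hnd : (Finset.univ.val.map fun i => (X * Y) i i).Nodup :=
    Finset.univ.nodup.map hinj
  rw [← h3] at hnd
  intro i j hij
  exact Multiset.inj_on_of_nodup_map hnd i (by simp) j (by simp) hij

open Matrix in
/-- Simultaneous normal form of `X` and `Y` for triangular products with separated diagonals: after
unipotent changes of basis, the entry `(i, j)` vanishes unless the diagonal entries `(X * Y) i i`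
and `(Y * X) j j` agree in the residue field. -/
theorem exists_normal_form {n : ℕ} {A : Type*} [CommRing A] [IsLocalRing A]
    (X Y : Matrix (Fin n) (Fin n) A)
    (hXY : (X * Y).BlockTriangular OrderDual.toDual) (hYX : (Y * X).BlockTriangular id)
    (hunit : ∀ i j, i ≠ j → IsUnit ((X * Y) i i - (X * Y) j j)) :
    ∃ (T : Fin n → Fin n → Prop) (B C P Q : Matrix (Fin n) (Fin n) A),
      (∀ i j l, T i l → T j l → i = j) ∧ (∀ i j l, T l i → T l j → i = j) ∧
      B.BlockTriangular OrderDual.toDual ∧ (∀ i, B i i = 1) ∧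
      C.BlockTriangular id ∧ (∀ i, C i i = 1) ∧
      (∀ i j, ¬ T i j → P i j = 0) ∧ (∀ i j, ¬ T i j → Q j i = 0) ∧
      X = B * P * C.adjugate ∧ Y = C * Q * B.adjugate := by
  let r := IsLocalRing.residue A
  have hr : ∀ a : A, IsUnit a ↔ r a ≠ 0 := fun a =>
    (IsLocalRing.residue_ne_zero_iff_isUnit a).symm
  have hmX : X.map r * Y.map r = (X * Y).map r := (Matrix.map_mul ..).symm
  have hmY : Y.map r * X.map r = (Y * X).map r := (Matrix.map_mul ..).symm
  have hdinj : Function.Injective fun i => r ((X * Y) i i) := by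
    intro i j hij
    by_contra hne
    refine (hr _).mp (hunit i j hne) ?_
    rw [map_sub, sub_eq_zero]
    exact hij
  have huinj : Function.Injective fun i => r ((Y * X) i i) := by
    have := injective_diag_mul_comm (X.map r) (Y.map r) ?_ ?_ ?_
    · rw [hmY] at this; exact this
    · rw [hmX]; exact hXY.map r
    · rw [hmY]; exact hYX.map r
    · rw [hmX]; exact hdinj
  have hunit' : ∀ i j, i ≠ j → IsUnit ((Y * X) i i - (Y * X) j j) := fun i j hij => by
    rw [hr, map_sub, sub_ne_zero]
    exact fun h => hij (huinj h)
  obtain ⟨B, hB, hB1, hLB⟩ := hXY.exists_mul_eq_mul_diagonal OrderDual.toDual.injective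
    (fun M hM => det_of_isLowerTriangular M hM) hunit
  obtain ⟨C, hC, hC1, hUC⟩ := hYX.exists_mul_eq_mul_diagonal Function.injective_id
    (fun M hM => det_of_isUpperTriangular hM) hunit'
  have hBdet : B.det = 1 := det_eq_one_of_diag_eq_one (det_of_isLowerTriangular B hB) hB1
  have hCdet : C.det = 1 := det_eq_one_of_diag_eq_one (det_of_isUpperTriangular hC) hC1
  have hBB : B * B.adjugate = 1 := by rw [mul_adjugate, hBdet, one_smul]
  have hBB' : B.adjugate * B = 1 := by rw [adjugate_mul, hBdet, one_smul]
  have hCC : C * C.adjugate = 1 := by rw [mul_adjugate, hCdet, one_smul]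
  have hCC' : C.adjugate * C = 1 := by rw [adjugate_mul, hCdet, one_smul]
  set D := diagonal fun i => (X * Y) i i with hD
  set E := diagonal fun i => (Y * X) i i with hE
  have hBL : B.adjugate * (X * Y) = D * B.adjugate := by
    calc B.adjugate * (X * Y) = B.adjugate * (X * Y) * (B * B.adjugate) := by rw [hBB, mul_one]
      _ = B.adjugate * (X * Y * B) * B.adjugate := by simp only [mul_assoc]
      _ = (B.adjugate * B) * D * B.adjugate := by rw [hLB]; simp only [mul_assoc]
      _ = D * B.adjugate := by rw [hBB', one_mul]
  have hCU : C.adjugate * (Y * X) = E * C.adjugate := by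
    calc C.adjugate * (Y * X) = C.adjugate * (Y * X) * (C * C.adjugate) := by rw [hCC, mul_one]
      _ = C.adjugate * (Y * X * C) * C.adjugate := by simp only [mul_assoc]
      _ = (C.adjugate * C) * E * C.adjugate := by rw [hUC]; simp only [mul_assoc]
      _ = E * C.adjugate := by rw [hCC', one_mul]
  have hP : D * (B.adjugate * X * C) = (B.adjugate * X * C) * E := by
    calc D * (B.adjugate * X * C) = D * B.adjugate * X * C := by simp only [mul_assoc]
      _ = B.adjugate * X * (Y * X * C) := by rw [← hBL]; simp only [mul_assoc]
      _ = _ := by rw [hUC]; simp only [mul_assoc]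
  have hQ : E * (C.adjugate * Y * B) = (C.adjugate * Y * B) * D := by
    calc E * (C.adjugate * Y * B) = E * C.adjugate * Y * B := by simp only [mul_assoc]
      _ = C.adjugate * Y * (X * Y * B) := by rw [← hCU]; simp only [mul_assoc]
      _ = _ := by rw [hLB]; simp only [mul_assoc]
  have hsub : ∀ i j, r ((X * Y) i i) ≠ r ((Y * X) j j) →
      IsUnit ((X * Y) i i - (Y * X) j j) := fun i j h => by
    rw [hr, map_sub, sub_ne_zero]; exact h
  refine ⟨fun i j => r ((X * Y) i i) = r ((Y * X) j j), B, C, B.adjugate * X * C,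
    C.adjugate * Y * B, fun i j l hi hj => hdinj (hi.trans hj.symm),
    fun i j l hi hj => huinj (hi.symm.trans hj), hB, hB1, hC, hC1, ?_, ?_, ?_, ?_⟩
  · intro i j hij
    have h := congrFun (congrFun hP i) j
    rw [hD, hE, diagonal_mul, mul_diagonal] at h
    refine (hsub i j hij).mul_right_eq_zero.mp ?_
    rw [sub_mul, h, mul_comm, sub_self]
  · intro i j hij
    have h := congrFun (congrFun hQ j) i
    rw [hD, hE, diagonal_mul, mul_diagonal] at h
    refine (hsub i j hij).mul_right_eq_zero.mp ?_
    rw [sub_mul, h, mul_comm, sub_self]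
  · calc X = (B * B.adjugate) * X * (C * C.adjugate) := by rw [hBB, hCC, one_mul, mul_one]
      _ = _ := by simp only [mul_assoc]
  · calc Y = (C * C.adjugate) * Y * (B * B.adjugate) := by rw [hBB, hCC, one_mul, mul_one]
      _ = _ := by simp only [mul_assoc]

open Matrix in
theorem triangular_of_normal_form {n : ℕ} {S : Type*} [CommRing S]
    {T : Fin n → Fin n → Prop} (hT : ∀ i j l, T i l → T j l → i = j)
    (hT' : ∀ i j l, T l i → T l j → i = j) {B C P Q : Matrix (Fin n) (Fin n) S}
    (hB : B.BlockTriangular OrderDual.toDual) (hB1 : ∀ i, B i i = 1)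
    (hC : C.BlockTriangular id) (hC1 : ∀ i, C i i = 1)
    (hP : ∀ i j, ¬ T i j → P i j = 0) (hQ : ∀ i j, ¬ T i j → Q j i = 0) :
    ((B * P * C.adjugate) * (C * Q * B.adjugate)).BlockTriangular OrderDual.toDual ∧
    ((C * Q * B.adjugate) * (B * P * C.adjugate)).BlockTriangular id := by
  have hBdet : B.det = 1 := det_eq_one_of_diag_eq_one (det_of_isLowerTriangular B hB) hB1
  have hCdet : C.det = 1 := det_eq_one_of_diag_eq_one (det_of_isUpperTriangular hC) hC1
  have hBB' : B.adjugate * B = 1 := by rw [adjugate_mul, hBdet, one_smul]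
  have hCC' : C.adjugate * C = 1 := by rw [adjugate_mul, hCdet, one_smul]
  have hPQ : ∀ i j, i ≠ j → (P * Q) i j = 0 := fun i j hij => by
    rw [Matrix.mul_apply]
    refine Finset.sum_eq_zero fun l _ => ?_
    by_cases h : T i l
    · rw [hQ j l fun h' => hij (hT _ _ _ h h'), mul_zero]
    · rw [hP _ _ h, zero_mul]
  have hQP : ∀ i j, i ≠ j → (Q * P) i j = 0 := fun i j hij => by
    rw [Matrix.mul_apply]
    refine Finset.sum_eq_zero fun l _ => ?_
    by_cases h : T l i
    · rw [hP l j fun h' => hij (hT' _ _ _ h h'), mul_zero]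
    · rw [hQ _ _ h, zero_mul]
  constructor
  · have : (B * P * C.adjugate) * (C * Q * B.adjugate) = B * (P * Q) * B.adjugate := by
      calc _ = B * P * (C.adjugate * C) * Q * B.adjugate := by simp only [mul_assoc]
        _ = _ := by rw [hCC', mul_one]; simp only [mul_assoc]
    rw [this]
    refine (hB.mul fun i j hij => hPQ i j ?_).mul (hB.adjugate_of_det_eq_one hBdet)
    rintro rfl; exact lt_irrefl _ hij
  · have : (C * Q * B.adjugate) * (B * P * C.adjugate) = C * (Q * P) * C.adjugate := by
      calc _ = C * Q * (B.adjugate * B) * P * C.adjugate := by simp only [mul_assoc]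
        _ = _ := by rw [hBB', mul_one]; simp only [mul_assoc]
    rw [this]
    refine (hC.mul fun i j hij => hQP i j ?_).mul (hC.adjugate_of_det_eq_one hCdet)
    rintro rfl; exact lt_irrefl _ hij

open Matrix MvPolynomial in
theorem map_eq_zero_of_mem_radical {n : ℕ} {A : Type*} [CommRing A] [IsLocalRing A] [Algebra ℂ A]
    (φ : PolyRing n →ₐ[ℂ] A) (hφ : ∀ f ∈ upperLowerIdeal n, φ f = 0)
    (hunit : ∀ i j, i ≠ j → IsUnit (φ ((Xgen n * Ygen n) i i - (Xgen n * Ygen n) j j)))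
    {f : PolyRing n} (hf : f ∈ (upperLowerIdeal n).radical) : φ f = 0 := by
  classical
  have hmX : (Xgen n).map φ * (Ygen n).map φ = (Xgen n * Ygen n).map φ := (Matrix.map_mul ..).symm
  have hmY : (Ygen n).map φ * (Xgen n).map φ = (Ygen n * Xgen n).map φ := (Matrix.map_mul ..).symm
  obtain ⟨T, B, C, P, Q, hT, hT', hB, hB1, hC, hC1, hP, hQ, hX, hY⟩ :=
    exists_normal_form ((Xgen n).map φ) ((Ygen n).map φ)
      (by rw [hmX]; exact fun i j hij => hφ _ (mul_apply_mem_upperLowerIdeal hij))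
      (by rw [hmY]; exact fun i j hij => hφ _ (mul_apply_mem_upperLowerIdeal' hij))
      (by
        intro i j hij
        rw [hmX]
        have := hunit i j hij
        rwa [map_sub] at this)
  let B' : Matrix (Fin n) (Fin n) (MvPolynomial ((Fin n × Fin n) × Fin 4) ℂ) := Matrix.of fun i j =>
    if i = j then 1 else if i < j then 0 else X ((i, j), 0)
  let C' : Matrix (Fin n) (Fin n) (MvPolynomial ((Fin n × Fin n) × Fin 4) ℂ) := Matrix.of fun i j =>
    if i = j then 1 else if j < i then 0 else X ((i, j), 1)
  let P' : Matrix (Fin n) (Fin n) (MvPolynomial ((Fin n × Fin n) × Fin 4) ℂ) :=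
    Matrix.of fun i j => if T i j then X ((i, j), 2) else 0
  let Q' : Matrix (Fin n) (Fin n) (MvPolynomial ((Fin n × Fin n) × Fin 4) ℂ) :=
    Matrix.of fun i j => if T j i then X ((i, j), 3) else 0
  let ev : MvPolynomial ((Fin n × Fin n) × Fin 4) ℂ →ₐ[ℂ] A := aeval fun p =>
    ![B p.1.1 p.1.2, C p.1.1 p.1.2, P p.1.1 p.1.2, Q p.1.1 p.1.2] p.2
  have hevB : ev.mapMatrix B' = B := by
    ext i j
    rcases lt_trichotomy i j with h | h | h
    · simp [B', h, h.ne, hB (show OrderDual.toDual j < OrderDual.toDual i from h)]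
    · subst h; simp [B', hB1]
    · simp [B', h.ne', h.not_gt, ev]
  have hevC : ev.mapMatrix C' = C := by
    ext i j
    rcases lt_trichotomy i j with h | h | h
    · simp [C', h.ne, h.not_gt, ev]
    · subst h; simp [C', hC1]
    · simp [C', h, h.ne', hC (show id j < id i from h)]
  have hevP : ev.mapMatrix P' = P := by
    ext i j
    by_cases h : T i j
    · simp [P', h, ev]
    · simp [P', h, hP i j h]
  have hevQ : ev.mapMatrix Q' = Q := by
    ext i j
    by_cases h : T j i
    · simp [Q', h, ev]
    · simp [Q', h, hQ j i h]
  let X' := B' * P' * C'.adjugate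
  let Y' := C' * Q' * B'.adjugate
  let Φ : PolyRing n →ₐ[ℂ] MvPolynomial ((Fin n × Fin n) × Fin 4) ℂ :=
    aeval (Sum.elim (fun p => X' p.1 p.2) (fun p => Y' p.1 p.2))
  have hΦX : (Xgen n).map Φ = X' := by ext i j : 2; simp [Xgen, Φ]
  have hΦY : (Ygen n).map Φ = Y' := by ext i j : 2; simp [Ygen, Φ]
  have hevX : ev.mapMatrix X' = (Xgen n).map φ := by
    simp only [X', map_mul, AlgHom.map_adjugate, hevB, hevP, hevC, hX]
  have hevY : ev.mapMatrix Y' = (Ygen n).map φ := by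
    simp only [Y', map_mul, AlgHom.map_adjugate, hevB, hevQ, hevC, hY]
  have hcomp : ev.comp Φ = φ := by
    ext p
    rcases p with ⟨i, j⟩ | ⟨i, j⟩
    · simpa [Φ, Xgen] using congrFun (congrFun hevX i) j
    · simpa [Φ, Ygen] using congrFun (congrFun hevY i) j
  obtain ⟨h1, h2⟩ := triangular_of_normal_form hT hT' (B := B') (C := C') (P := P')
    (Q := Q')
    (fun i j hij => by
      have hij' : i < j := hij
      simp [B', hij', hij'.ne])
    (fun i => by simp [B'])
    (fun i j hij => by
      have hij' : j < i := hij
      simp [C', hij', hij'.ne'])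
    (fun i => by simp [C'])
    (fun i j h => by simp [P', h]) (fun i j h => by simp [Q', h])
  have hJ : upperLowerIdeal n ≤ RingHom.ker Φ := by
    refine Ideal.span_le.mpr ?_
    rintro f (⟨i, j, h, rfl⟩ | ⟨i, j, h, rfl⟩)
    · change ((Xgen n * Ygen n).map Φ) i j = 0
      rw [Matrix.map_mul, hΦX, hΦY]
      exact h1 h
    · change ((Ygen n * Xgen n).map Φ) i j = 0
      rw [Matrix.map_mul, hΦX, hΦY]
      exact h2 h
  obtain ⟨m, hm⟩ := hf
  have h0 : Φ f = 0 := by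
    have := hJ hm
    rw [RingHom.mem_ker, map_pow] at this
    exact eq_zero_of_pow_eq_zero this
  rw [← hcomp, AlgHom.comp_apply, h0, map_zero]

theorem exists_notMem_mul_mem_of_map_eq_zero.{u, v} {k : Type v} {R : Type u} [CommRing k]
    [CommRing R] [Algebra k R]
    {J P : Ideal R} [P.IsPrime] (hJP : J ≤ P) (b : R)
    (h : ∀ (A : Type u) [CommRing A] [IsLocalRing A] [Algebra k A] (φ : R →ₐ[k] A),
      (∀ x ∈ J, φ x = 0) → (∀ x ∉ P, IsUnit (φ x)) → φ b = 0) :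
    ∃ m ∉ P, m * b ∈ J := by
  let L := Localization.AtPrime P
  let I := J.map (algebraMap R L)
  have hI : I ≤ IsLocalRing.maximalIdeal L := Ideal.map_le_iff_le_comap.mpr fun x hx =>
    (IsLocalization.AtPrime.to_map_mem_maximal_iff L P x).mpr (hJP hx)
  have : Nontrivial (L ⧸ I) := Ideal.Quotient.nontrivial_iff.mpr
    (ne_top_of_le_ne_top (IsLocalRing.maximalIdeal.isMaximal L).ne_top hI)
  have : IsLocalRing (L ⧸ I) :=
    IsLocalRing.of_surjective' (Ideal.Quotient.mk I) Ideal.Quotient.mk_surjective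
  have h0 := h (L ⧸ I) ((Ideal.Quotient.mkₐ k I).comp (IsScalarTower.toAlgHom k R L))
    (fun x hx => Ideal.Quotient.eq_zero_iff_mem.mpr (Ideal.mem_map_of_mem _ hx))
    (fun x hx => (IsLocalization.map_units L (⟨x, hx⟩ : P.primeCompl)).map (Ideal.Quotient.mk I))
  obtain ⟨m, hm, hmb⟩ := (IsLocalization.algebraMap_mem_map_algebraMap_iff P.primeCompl L J b).mp
    (Ideal.Quotient.eq_zero_iff_mem.mp h0)
  exact ⟨m, hm, hmb⟩

/-- The ideal `J` is a radical ideal of `R`. -/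
theorem stmt3 (n : ℕ) (hn : 1 ≤ n) : (upperLowerIdeal n).IsRadical := by
  by_contra hnr
  obtain ⟨c, hc, hcJ⟩ := SetLike.not_le_iff_exists.mp hnr
  let J := upperLowerIdeal n
  let M : Submodule (PolyRing n) (PolyRing n ⧸ J) := Submodule.map (Submodule.mkQ J) J.radical
  let c' : M := ⟨Submodule.Quotient.mk c, c, hc, rfl⟩
  have hc' : c' ≠ 0 := fun h => hcJ ((Submodule.Quotient.mk_eq_zero J).mp (congrArg Subtype.val h))
  obtain ⟨P, hP, -⟩ := exists_le_isAssociatedPrime_of_isNoetherianRing (PolyRing n) c' hc'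
  obtain ⟨hPp, ⟨_, b, hb, rfl⟩, hPb⟩ := Submodule.isAssociatedPrime_iff.mp hP
  have hPiff : ∀ x, x ∈ P ↔ x * b ∈ J := by
    intro x
    rw [hPb, Submodule.mem_colon_singleton, Submodule.mem_bot, Subtype.ext_iff]
    exact Submodule.Quotient.mk_eq_zero J
  have hJP : J ≤ P := fun x hx => (hPiff x).mpr (Ideal.mul_mem_right _ _ hx)
  obtain ⟨m, hm, hmb⟩ := exists_notMem_mul_mem_of_map_eq_zero (k := ℂ) hJP b
    fun A _ _ _ φ hφ hunit => map_eq_zero_of_mem_radical φ hφ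
      (fun i j hij => hunit _ (diag_sub_diag_notMem_of_mem_iff P hPp b hPiff hij)) hb
  exact hm ((hPiff m).mpr hmb)
end
end

section
/- The set of minimal primes over the ideal J is exactly {𝕀(S_π) : π ∈ Sₙ}, and the map π ↦ 𝕀(S_π) is injective; that is, the irreducible components of D⁰ are exactly the n! orbit closures D⁰_π, one for each permutation π. -/
noncomputable section

/-- Evaluation of a polynomial at a point `(X, Y)` of `ℂ^{2n²}`. -/
def evalPt (n : ℕ) (p : MatC n × MatC n) : PolyRing n →+* ℂ :=
  MvPolynomial.eval (Sum.elim (fun q => p.1 q.1 q.2) (fun q => p.2 q.1 q.2))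

/-- The vanishing ideal `𝕀(S)` of a subset `S ⊆ ℂ^{2n²}`. -/
def vanishingIdeal (n : ℕ) (S : Set (MatC n × MatC n)) : Ideal (PolyRing n) :=
  ⨅ p ∈ S, RingHom.ker (evalPt n p)

/-- The permutation matrix `P_π`, with `(P_π)_{ij} = 1` iff `j = π(i)`. -/
def permMat {n : ℕ} (π : Equiv.Perm (Fin n)) : MatC n :=
  Matrix.of fun i j => if π i = j then 1 else 0

/-- The set `S_π = {(L P_π t U⁻¹, U s P_{π⁻¹} L⁻¹)}`, for `L` invertible lower
triangular, `U` invertible upper triangular, and `s, t` invertible diagonal. -/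
def Spi {n : ℕ} (π : Equiv.Perm (Fin n)) : Set (MatC n × MatC n) :=
  { p | ∃ (L U : MatC n) (ds dt : Fin n → ℂ),
      IsUnit L ∧ (∀ i j : Fin n, i < j → L i j = 0) ∧
      IsUnit U ∧ (∀ i j : Fin n, j < i → U i j = 0) ∧
      (∀ i, ds i ≠ 0) ∧ (∀ i, dt i ≠ 0) ∧
      p = (L * permMat π * Matrix.diagonal dt * U⁻¹,
           U * Matrix.diagonal ds * permMat π⁻¹ * L⁻¹) }

namespace Matrix

section Triangular

variable {ι α K : Type*} [Fintype ι] [LinearOrder α] {b : ι → α}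

lemma BlockTriangular.mul_apply_self [Semiring K] (hb : Function.Injective b)
    {A B : Matrix ι ι K} (hA : A.BlockTriangular b) (hB : B.BlockTriangular b) (i : ι) :
    (A * B) i i = A i i * B i i := by
  rw [mul_apply]
  refine Finset.sum_eq_single i (fun k _ hk => ?_) (by simp)
  rcases lt_or_gt_of_ne (hb.ne hk) with h | h
  · rw [hA h, zero_mul]
  · rw [hB h, mul_zero]

lemma BlockTriangular.aeval [DecidableEq ι] [CommSemiring K] {A : Matrix ι ι K} (hA : A.BlockTriangular b)
    (p : Polynomial K) : (Polynomial.aeval A p).BlockTriangular b :=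
  (Algebra.adjoin_le (S := blockTriangularSubalgebra K K b) (by simpa using hA))
    (Polynomial.aeval_mem_adjoin_singleton K A)

lemma BlockTriangular.aeval_apply_self [DecidableEq ι] [CommSemiring K] (hb : Function.Injective b)
    {A : Matrix ι ι K} (hA : A.BlockTriangular b) (p : Polynomial K) (i : ι) :
    Polynomial.aeval A p i i = p.eval (A i i) := by
  induction p using Polynomial.induction_on' with
  | add p q hp hq => simp [hp, hq]
  | monomial k a =>
    have hpow : ∀ k, (A ^ k) i i = A i i ^ k := by
      intro k
      induction k with
      | zero => simp
      | succ k ih => rw [pow_succ, (hA.pow k).mul_apply_self hb hA, ih, pow_succ]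
    rw [Polynomial.aeval_monomial, Polynomial.eval_monomial, ← Algebra.smul_def, smul_apply,
      hpow, smul_eq_mul]

/-- A triangular matrix with distinct diagonal entries is diagonalized by a triangular matrix
whose columns are columns of the spectral projections. -/
lemma BlockTriangular.exists_diagonalization [DecidableEq ι] [Field K] (hb : Function.Injective b)
    {A : Matrix ι ι K} (hA : A.BlockTriangular b) {a : ι → K} (ha : Function.Injective a)
    (hdiag : ∀ i, A i i = a i)
    (hchar : A.charpoly = ∏ i, (Polynomial.X - Polynomial.C (a i))) :
    ∃ L : Matrix ι ι K, L.BlockTriangular b ∧ (∀ i, L i i ≠ 0) ∧ A * L = L * diagonal a := by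
  classical
  let p : ι → Polynomial K := fun j =>
    ∏ k ∈ Finset.univ.erase j, (Polynomial.X - Polynomial.C (a k))
  refine ⟨of fun i j => Polynomial.aeval A (p j) i j, ?_, ?_, ?_⟩
  · intro i j hij
    exact hA.aeval (p j) hij
  · intro i
    rw [of_apply, hA.aeval_apply_self hb, hdiag, Polynomial.eval_prod, Finset.prod_ne_zero_iff]
    intro k hk
    simpa [sub_eq_zero] using fun h => Finset.ne_of_mem_erase hk (ha h.symm)
  · ext i j
    have h : (A - algebraMap K _ (a j)) * Polynomial.aeval A (p j) = 0 := by
      have := aeval_self_charpoly A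
      rw [hchar, ← Finset.mul_prod_erase _ _ (Finset.mem_univ j), map_mul] at this
      simpa using this
    rw [sub_mul, sub_eq_zero] at h
    have hij := congrFun (congrFun h i) j
    rw [mul_diagonal, of_apply]
    rw [← Algebra.smul_def, smul_apply, mul_apply] at hij
    rw [mul_apply]
    simpa [mul_comm] using hij

end Triangular

section Monomial

variable {ι K : Type*} [Fintype ι] [LinearOrder ι] [Field K]

/-- `M` has at most one nonzero entry in each row and in each column. -/
def IsMonomial (M : Matrix ι ι K) : Prop :=
  (∀ i j k, M i j ≠ 0 → M i k ≠ 0 → j = k) ∧ ∀ i j k, M i k ≠ 0 → M j k ≠ 0 → i = j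

/-- The existence of an invertible `N` with `M * N` lower triangular and `N * M` upper triangular,
such that `M * N` has diagonal `d` as soon as `M` is invertible. -/
def HasAdaptedFactor (d : ι → K) (M : Matrix ι ι K) : Prop :=
  ∃ N : Matrix ι ι K, IsUnit N ∧ (M * N).IsLowerTriangular ∧ (N * M).IsUpperTriangular ∧
    (IsUnit M → ∀ i, (M * N) i i = d i)

lemma HasAdaptedFactor.of_left_mul {d : ι → K} {A A' M : Matrix ι ι K}
    (hA : A.IsLowerTriangular) (hA' : A'.IsLowerTriangular) (h : A' * A = 1)
    (hM : HasAdaptedFactor d (A * M)) : HasAdaptedFactor d M := by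
  obtain ⟨N, hN, hl, hu, hd⟩ := hM
  have hAu : IsUnit A := IsUnit.of_mul_eq_one_right A' h
  have hMN : M * (N * A) = A' * (A * M * N) * A := by
    simp only [mul_assoc, ← mul_assoc A' A, h, one_mul]
  refine ⟨N * A, hN.mul hAu, hMN ▸ (hA'.mul hl).mul hA, by rwa [mul_assoc], fun hMu i => ?_⟩
  have hone : A' i i * A i i = 1 := by
    rw [← hA'.mul_apply_self OrderDual.toDual.injective hA, h, one_apply_eq]
  rw [hMN, (hA'.mul hl).mul_apply_self OrderDual.toDual.injective hA,
    hA'.mul_apply_self OrderDual.toDual.injective hl, hd (hAu.mul hMu), mul_right_comm, hone,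
    one_mul]

lemma HasAdaptedFactor.of_mul_right {d : ι → K} {A A' M : Matrix ι ι K}
    (hA : A.IsUpperTriangular) (hA' : A'.IsUpperTriangular) (h : A * A' = 1)
    (hM : HasAdaptedFactor d (M * A)) : HasAdaptedFactor d M := by
  obtain ⟨N, hN, hl, hu, hd⟩ := hM
  have hAu : IsUnit A := IsUnit.of_mul_eq_one A' h
  have hNM : A * N * M = A * (N * (M * A)) * A' := by simp only [mul_assoc, h, mul_one]
  rw [mul_assoc] at hl hd
  exact ⟨A * N, hAu.mul hN, hl, hNM ▸ (hA.mul hu).mul hA', fun hMu => hd (hMu.mul hAu)⟩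

lemma IsMonomial.hasAdaptedFactor {d : ι → K} (hd : ∀ i, d i ≠ 0) {M : Matrix ι ι K}
    (hM : M.IsMonomial) : HasAdaptedFactor d M := by
  classical
  obtain ⟨σ, hσ⟩ : ∃ σ : Equiv.Perm ι, ∀ i j, M i j ≠ 0 → σ i = j := by
    let f : ι → ι := fun i => if h : ∃ j, M i j ≠ 0 then h.choose else i
    have hf : ∀ i j, M i j ≠ 0 → M i (f i) ≠ 0 := fun i j hj => by
      have h : ∃ j, M i j ≠ 0 := ⟨j, hj⟩
      simpa only [f, dif_pos h] using h.choose_spec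
    obtain ⟨g, hg⟩ := Finset.exists_equiv_extend_of_card_eq (t := (Finset.univ : Finset ι)) rfl
      (s := {i | ∃ j, M i j ≠ 0}) (f := f) (Finset.subset_univ _) (by
        intro i hi i' hi' hii
        obtain ⟨j, hj⟩ := (Finset.mem_filter.1 hi).2
        obtain ⟨j', hj'⟩ := (Finset.mem_filter.1 hi').2
        refine hM.2 i i' (f i) (hf i j hj) ?_
        rw [hii]
        exact hf i' j' hj')
    refine ⟨g.trans (Equiv.subtypeUnivEquiv Finset.mem_univ), fun i j hj => ?_⟩
    have : (g i : ι) = f i := hg i (by simpa using ⟨j, hj⟩)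
    simpa [this] using hM.1 i _ _ (hf i j hj) hj
  let v : ι → K := fun i => if M i (σ i) = 0 then 1 else d i / M i (σ i)
  have hv : ∀ i, v i ≠ 0 := fun i => by
    by_cases h : M i (σ i) = 0 <;> simp [v, h, hd i]
  let N : Matrix ι ι K := of fun j i => if σ i = j then v i else 0
  have hMN : ∀ i k, (M * N) i k = M i (σ k) * v k := fun i k => by
    simp [N, mul_apply]
  have hNM : ∀ i k, (N * M) i k = v (σ.symm i) * M (σ.symm i) k := fun i k => by
    rw [mul_apply, Finset.sum_eq_single (σ.symm i)]
    · simp [N]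
    · intro b _ hb
      have : σ b ≠ i := fun h => hb (by simp [← h])
      simp [N, this]
    · simp
  refine ⟨N, ?_, fun i k hik => ?_, fun i k hik => ?_, fun hMu i => ?_⟩
  · refine IsUnit.of_mul_eq_one (of fun i j => if σ i = j then (v i)⁻¹ else 0) ?_
    ext i k
    rw [mul_apply, Finset.sum_eq_single (σ.symm i)]
    · simp [N, hv, one_apply]
    · intro b _ hb
      have : σ b ≠ i := fun h => hb (by simp [← h])
      simp [N, this]
    · simp
  · rw [hMN]
    by_contra h
    have := σ.injective (hσ i _ (left_ne_zero_of_mul h))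
    simp [this] at hik
  · rw [hNM]
    by_contra h
    have := hσ _ _ (right_ne_zero_of_mul h)
    simp only [Equiv.apply_symm_apply] at this
    simp [this] at hik
  · have hne : M i (σ i) ≠ 0 := by
      intro h0
      have hrow : ∀ j, M i j = 0 := fun j => by
        by_contra hj
        exact hj (hσ i j hj ▸ h0)
      exact ((isUnit_iff_isUnit_det M).1 hMu).ne_zero (det_eq_zero_of_row_eq_zero i hrow)
    rw [hMN]
    simp [v, hne, mul_div_cancel₀]

lemma lex_card_support_lt {M N : Matrix ι ι K} {i k : ι} (hlt : ∀ r < i, ∀ l, N r l = M r l)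
    (hi : ∀ l, l ≠ k → N i l = M i l) (hN : N i k = 0) (hM : M i k ≠ 0) :
    toLex (fun r => Set.ncard {l | N r l ≠ 0}) < toLex (fun r => Set.ncard {l | M r l ≠ 0}) := by
  refine ⟨i, fun r hr => ?_, ?_⟩
  · simp [hlt r hr]
  · refine Set.ncard_lt_ncard ⟨fun l hl => ?_, fun h => h hM hN⟩ (Set.toFinite _)
    have hlk : l ≠ k := by rintro rfl; exact hl hN
    simpa [← hi l hlk] using hl

/-- Gaussian elimination by lower triangular row and upper triangular column operations. -/
lemma hasAdaptedFactor {d : ι → K} (hd : ∀ i, d i ≠ 0) (M : Matrix ι ι K) :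
    HasAdaptedFactor d M := by
  classical
  induction M using (InvImage.wf (fun M : Matrix ι ι K =>
    toLex fun r => Set.ncard {l | M r l ≠ 0}) wellFounded_lt).induction with
  | _ M ih =>
  let V : Set ι := {i | (∃ j k, j < k ∧ M i j ≠ 0 ∧ M i k ≠ 0) ∨
    ∃ i' j, i' < i ∧ M i' j ≠ 0 ∧ M i j ≠ 0}
  rcases V.eq_empty_or_nonempty with hV | hV
  · have hVi : ∀ i, i ∉ V := fun i => by simp [hV]
    refine IsMonomial.hasAdaptedFactor hd ⟨fun i j k hj hk => ?_, fun i j k hi hj => ?_⟩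
    · rcases lt_trichotomy j k with h | h | h
      · exact absurd (Or.inl ⟨j, k, h, hj, hk⟩) (hVi i)
      · exact h
      · exact absurd (Or.inl ⟨k, j, h, hk, hj⟩) (hVi i)
    · rcases lt_trichotomy i j with h | h | h
      · exact absurd (Or.inr ⟨i, k, h, hi, hj⟩) (hVi j)
      · exact h
      · exact absurd (Or.inr ⟨j, k, h, hj, hi⟩) (hVi i)
  obtain ⟨i, hiV, hmin⟩ := wellFounded_lt.has_min V hV
  by_cases hcol : ∃ i' j, i' < i ∧ M i' j ≠ 0 ∧ M i j ≠ 0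
  · obtain ⟨i', j, hlt, hi'j, hij⟩ := hcol
    have hrow : ∀ l, l ≠ j → M i' l = 0 := fun l hl => by
      by_contra h
      refine hmin i' (Or.inl ?_) hlt
      rcases lt_or_gt_of_ne hl with hl | hl
      exacts [⟨l, j, hl, h, hi'j⟩, ⟨j, l, hl, hi'j, h⟩]
    refine HasAdaptedFactor.of_left_mul (A := transvection i i' (-(M i j / M i' j)))
      (A' := transvection i i' (M i j / M i' j)) (blockTriangular_transvection hlt.le _)
      (blockTriangular_transvection hlt.le _)
      (by rw [transvection_mul_transvection_same _ _ hlt.ne', add_neg_cancel, transvection_zero])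
      (ih _ (lex_card_support_lt (i := i) (k := j) (fun r hr l => ?_) (fun l hl => ?_) ?_ hij))
    · rw [transvection_mul_apply_of_ne _ _ _ _ hr.ne]
    · rw [transvection_mul_apply_same, hrow l hl, mul_zero, add_zero]
    · rw [transvection_mul_apply_same]
      field_simp
      ring
  · obtain ⟨j, k, hjk, hij, hik⟩ := hiV.resolve_right hcol
    have hzero : ∀ r < i, M r j = 0 := fun r hr => by
      by_contra h
      exact hcol ⟨r, j, hr, h, hij⟩
    refine HasAdaptedFactor.of_mul_right (A := transvection j k (-(M i k / M i j)))
      (A' := transvection j k (M i k / M i j)) (blockTriangular_transvection hjk.le _)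
      (blockTriangular_transvection hjk.le _)
      (by rw [transvection_mul_transvection_same _ _ hjk.ne, neg_add_cancel, transvection_zero])
      (ih _ (lex_card_support_lt (i := i) (k := k) (fun r hr l => ?_) (fun l hl => ?_) ?_ hik))
    · by_cases hl : l = k
      · rw [hl, mul_transvection_apply_same, hzero r hr, mul_zero, add_zero]
      · rw [mul_transvection_apply_of_ne _ _ _ _ hl]
    · rw [mul_transvection_apply_of_ne _ _ _ _ hl]
    · rw [mul_transvection_apply_same]
      field_simp
      ring

end Monomial

end Matrix

open Polynomial Matrix Filter

section Curves

variable {n : ℕ}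

lemma mem_vanishingIdeal_iff {S : Set (MatC n × MatC n)} {f : PolyRing n} :
    f ∈ vanishingIdeal n S ↔ ∀ p ∈ S, evalPt n p f = 0 := by
  simp [vanishingIdeal, Submodule.mem_iInf, RingHom.mem_ker]

lemma Polynomial.eventually_cofinite_eval_ne_zero {p : ℂ[X]} (hp : p ≠ 0) :
    ∀ᶠ z in cofinite, p.eval z ≠ 0 := by
  simpa [eventually_cofinite] using finite_setOfPred_isRoot hp

/-- Along a polynomial curve of pairs of matrices, a polynomial function is polynomial. -/
lemma exists_eval_eq_evalPt (A B : Matrix (Fin n) (Fin n) ℂ[X]) (f : PolyRing n) :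
    ∃ F : ℂ[X], ∀ z, F.eval z = evalPt n (A.map (eval z), B.map (eval z)) f := by
  refine ⟨MvPolynomial.aeval (Sum.elim (fun q => A q.1 q.2) fun q => B q.1 q.2) f, fun z => ?_⟩
  rw [← coe_evalRingHom, MvPolynomial.aeval_def, MvPolynomial.hom_eval₂, evalPt,
    MvPolynomial.eval, MvPolynomial.coe_eval₂Hom]
  congr 1
  · ext
    simp
  · funext q
    rcases q with q | q <;> simp

/-- The pencil `A + t B`, as a matrix of polynomials in `t`. -/
def pencil (A B : MatC n) : Matrix (Fin n) (Fin n) ℂ[X] :=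
  of fun i j => C (A i j) + X * C (B i j)

@[simp]
lemma pencil_map_eval (A B : MatC n) (z : ℂ) : (pencil A B).map (eval z) = A + z • B := by
  ext i j
  simpa [pencil] using mul_comm _ _

lemma evalPt_eq_zero_of_eventually {S : Set (MatC n × MatC n)} {f : PolyRing n}
    (hf : f ∈ vanishingIdeal n S) {A A' B B' : MatC n}
    (h : ∀ᶠ z : ℂ in cofinite, (A + z • A', B + z • B') ∈ S) : evalPt n (A, B) f = 0 := by
  obtain ⟨F, hF⟩ := exists_eval_eq_evalPt (pencil A A') (pencil B B') f
  simp only [pencil_map_eval] at hF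
  have hF0 : F = 0 := by
    by_contra hne
    obtain ⟨z, hz, hz'⟩ := ((eventually_cofinite_eval_ne_zero hne).and h).exists
    exact hz (by rw [hF, mem_vanishingIdeal_iff.1 hf _ hz'])
  simpa [hF0] using (hF 0).symm

lemma eventually_isUnit_add_smul (A : MatC n) {B : MatC n} (hB : IsUnit B) :
    ∀ᶠ z : ℂ in cofinite, IsUnit (A + z • B) := by
  obtain ⟨u, rfl⟩ := hB
  filter_upwards [eventually_cofinite_eval_ne_zero
    (charpoly_monic (-((u⁻¹ : (MatC n)ˣ) * A : MatC n))).ne_zero] with z hz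
  rw [eval_charpoly] at hz
  have h : A + z • (u : MatC n) =
      u * (scalar (Fin n) z - -((u⁻¹ : (MatC n)ˣ) * A : MatC n)) := by
    rw [sub_neg_eq_add, mul_add, ← mul_assoc, Units.mul_inv, one_mul, add_comm, scalar_apply,
      ← smul_one_eq_diagonal, mul_smul_comm, mul_one]
  rw [h]
  exact u.isUnit.mul ((isUnit_iff_isUnit_det _).2 hz.isUnit)

lemma eventually_injective_add_mul (a : Fin n → ℂ) {d : Fin n → ℂ} (hd : Function.Injective d) :
    ∀ᶠ z : ℂ in cofinite, Function.Injective fun i => a i + z * d i := by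
  have h : ∀ i j, ∀ᶠ z : ℂ in cofinite, a i + z * d i = a j + z * d j → i = j := fun i j => by
    by_cases hij : i = j
    · simp [hij]
    refine (Set.Subsingleton.finite fun z hz w hw => ?_)
    simp only [Set.mem_compl_iff, Set.mem_ofPred_eq, Classical.not_imp] at hz hw
    have hne : d i - d j ≠ 0 := sub_ne_zero.2 (hd.ne hij)
    apply mul_right_cancel₀ hne
    linear_combination hz.1 - hw.1
  filter_upwards [eventually_all.2 fun i => eventually_all.2 (h i)] with z hz i j
  exact hz i j

end Curves

section PermutationStrata

variable {n : ℕ}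

lemma permMat_mul_apply (π : Equiv.Perm (Fin n)) (M : MatC n) (i j : Fin n) :
    (permMat π * M) i j = M (π i) j := by
  simp [permMat, mul_apply]

lemma permMat_mul_inv (π : Equiv.Perm (Fin n)) : permMat π * permMat π⁻¹ = 1 := by
  ext i j
  rw [permMat_mul_apply]
  simp [permMat, one_apply]

lemma permMat_inv_mul (π : Equiv.Perm (Fin n)) : permMat π⁻¹ * permMat π = 1 := by
  simpa using permMat_mul_inv π⁻¹

lemma permMat_mul_diagonal_mul_inv (π : Equiv.Perm (Fin n)) (d : Fin n → ℂ) :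
    permMat π * diagonal d * permMat π⁻¹ = diagonal (d ∘ π) := by
  ext i j
  rw [mul_assoc, permMat_mul_apply, diagonal_mul]
  simp [permMat, diagonal_apply]

/-- On `S_π` the product `XY` is lower triangular and `YX` is upper triangular, and their
diagonals match up under `π`. -/
lemma triangular_of_mem_Spi {π : Equiv.Perm (Fin n)} {X Y : MatC n} (h : (X, Y) ∈ Spi π) :
    (X * Y).IsLowerTriangular ∧ (Y * X).IsUpperTriangular ∧
      ∀ i, (X * Y) i i = (Y * X) (π i) (π i) := by
  obtain ⟨L, U, ds, dt, hLu, hL, hUu, hU, -, -, h⟩ := h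
  obtain ⟨rfl, rfl⟩ := Prod.mk.inj h
  have hLl : L.IsLowerTriangular := fun i j hij => hL i j hij
  have hUl : U.IsUpperTriangular := fun i j hij => hU i j hij
  have := hLu.invertible
  have := hUu.invertible
  have hLi : (L⁻¹).IsLowerTriangular := blockTriangular_inv_of_blockTriangular hLl
  have hUi : (U⁻¹).IsUpperTriangular := blockTriangular_inv_of_blockTriangular hUl
  have hXY : L * permMat π * diagonal dt * U⁻¹ * (U * diagonal ds * permMat π⁻¹ * L⁻¹) =
      L * diagonal ((fun i => dt i * ds i) ∘ π) * L⁻¹ := by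
    rw [← permMat_mul_diagonal_mul_inv, ← diagonal_mul_diagonal]
    simp only [mul_assoc, inv_mul_cancel_left_of_invertible]
  have hYX : U * diagonal ds * permMat π⁻¹ * L⁻¹ * (L * permMat π * diagonal dt * U⁻¹) =
      U * diagonal (fun i => ds i * dt i) * U⁻¹ := by
    rw [← diagonal_mul_diagonal]
    have h (M : MatC n) : permMat π⁻¹ * (permMat π * M) = M := by
      rw [← mul_assoc, permMat_inv_mul, one_mul]
    simp only [mul_assoc, inv_mul_cancel_left_of_invertible, h]
  have conj_diag {α : Type} [LinearOrder α] {b : Fin n → α} (hb : Function.Injective b)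
      {A A' : MatC n} (hA : A.BlockTriangular b) (hA' : A'.BlockTriangular b) (h1 : A * A' = 1)
      (e : Fin n → ℂ) (i : Fin n) : (A * diagonal e * A') i i = e i := by
    have hone : A i i * A' i i = 1 := by
      rw [← hA.mul_apply_self hb hA', h1, one_apply_eq]
    rw [(hA.mul (blockTriangular_diagonal e)).mul_apply_self hb hA', mul_diagonal,
      mul_right_comm, hone, one_mul]
  rw [hXY, hYX]
  refine ⟨(hLl.mul (blockTriangular_diagonal _)).mul hLi,
    (hUl.mul (blockTriangular_diagonal _)).mul hUi, fun i => ?_⟩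
  rw [conj_diag OrderDual.toDual.injective hLl hLi (mul_inv_of_invertible L),
    conj_diag Function.injective_id hUl hUi (mul_inv_of_invertible U)]
  exact mul_comm _ _

/-- The generic pairs in the scheme lie in some `S_π`. -/
lemma exists_mem_Spi {X Y : MatC n} (hX : IsUnit X) (hY : IsUnit Y)
    (hXY : (X * Y).IsLowerTriangular) (hYX : (Y * X).IsUpperTriangular)
    (ha : Function.Injective fun i => (X * Y) i i) : ∃ π, (X, Y) ∈ Spi π := by
  set a : Fin n → ℂ := fun i => (X * Y) i i
  set b : Fin n → ℂ := fun i => (Y * X) i i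
  have hca : (X * Y).charpoly = ∏ i, (Polynomial.X - C (a i)) := by
    have hT : (X * Y)ᵀ.IsUpperTriangular := fun i j hij => hXY hij
    rw [← charpoly_transpose, charpoly_of_isUpperTriangular _ hT]
    rfl
  have hcb : (Y * X).charpoly = ∏ i, (Polynomial.X - C (b i)) :=
    charpoly_of_isUpperTriangular _ hYX
  have hb : Function.Injective b := by
    rw [← separable_prod_X_sub_C_iff, ← hcb, charpoly_mul_comm, hca, separable_prod_X_sub_C_iff]
    exact ha
  obtain ⟨L, hL, hLd, hLa⟩ := hXY.exists_diagonalization OrderDual.toDual.injective ha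
    (fun _ => rfl) hca
  obtain ⟨U, hU, hUd, hUb⟩ := hYX.exists_diagonalization Function.injective_id hb
    (fun _ => rfl) hcb
  have hLu : IsUnit L := by
    rw [isUnit_iff_isUnit_det, det_of_isLowerTriangular _ hL]
    exact (Finset.prod_ne_zero_iff.2 fun i _ => hLd i).isUnit
  have hUu : IsUnit U := by
    rw [isUnit_iff_isUnit_det, det_of_isUpperTriangular hU]
    exact (Finset.prod_ne_zero_iff.2 fun i _ => hUd i).isUnit
  have := hLu.invertible
  have := hUu.invertible
  set X' : MatC n := L⁻¹ * X * U with hX'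
  set Y' : MatC n := U⁻¹ * Y * L with hY'
  have hXY' : X' * Y' = diagonal a := by
    calc X' * Y' = L⁻¹ * (X * Y * L) := by
          simp only [hX', hY', mul_assoc, mul_inv_cancel_left_of_invertible]
      _ = diagonal a := by rw [hLa, inv_mul_cancel_left_of_invertible]
  have hYX' : Y' * X' = diagonal b := by
    calc Y' * X' = U⁻¹ * (Y * X * U) := by
          simp only [hX', hY', mul_assoc, mul_inv_cancel_left_of_invertible]
      _ = diagonal b := by rw [hUb, inv_mul_cancel_left_of_invertible]
  have hXe : ∀ i j, X' i j ≠ 0 → a i = b j := fun i j hij => by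
    have h : diagonal a * X' = X' * diagonal b := by rw [← hXY', ← hYX', mul_assoc]
    have := congrFun (congrFun h i) j
    rw [diagonal_mul, mul_diagonal, mul_comm] at this
    exact mul_left_cancel₀ hij this
  have hYe : ∀ j i, Y' j i ≠ 0 → a i = b j := fun j i hij => by
    have h : diagonal b * Y' = Y' * diagonal a := by rw [← hXY', ← hYX', mul_assoc]
    have := congrFun (congrFun h j) i
    rw [diagonal_mul, mul_diagonal, mul_comm] at this
    exact (mul_left_cancel₀ hij this).symm
  have hX'u : IsUnit X' := ((isUnit_nonsing_inv_iff.2 hLu).mul hX).mul hUu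
  have hY'u : IsUnit Y' := ((isUnit_nonsing_inv_iff.2 hUu).mul hY).mul hLu
  have hrow : ∀ i, ∃ j, X' i j ≠ 0 := fun i => by
    by_contra! h
    exact ((isUnit_iff_isUnit_det _).1 hX'u).ne_zero (det_eq_zero_of_row_eq_zero i h)
  choose f hf using hrow
  have hfa : ∀ i, a i = b (f i) := fun i => hXe _ _ (hf i)
  have hfi : Function.Injective f := fun i j hij => ha (by
    rw [hfa, hfa, hij])
  let π : Equiv.Perm (Fin n) := Equiv.ofBijective f (Finite.injective_iff_bijective.1 hfi)
  have hXπ : X' = permMat π * diagonal fun j => X' (π⁻¹ j) j := by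
    ext i j
    rw [permMat_mul_apply, diagonal_apply]
    split_ifs with h
    · simp [← h]
    · by_contra h0
      exact h (hb ((hfa i).symm.trans (hXe i j h0)))
  have hYπ : Y' = (diagonal fun j => Y' j (π⁻¹ j)) * permMat π⁻¹ := by
    ext j i
    rw [diagonal_mul]
    simp only [permMat, of_apply]
    split_ifs with h
    · simp [h]
    · rw [mul_zero]
      by_contra h0
      refine h ?_
      rw [Equiv.Perm.inv_eq_iff_eq]
      exact hb (((hfa i).symm.trans (hYe j i h0)).symm)
  refine ⟨π, L, U, fun j => Y' j (π⁻¹ j), fun j => X' (π⁻¹ j) j, hLu, fun i j hij => hL hij,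
    hUu, fun i j hij => hU hij, ?_, ?_, Prod.ext ?_ ?_⟩
  · intro j h0
    beta_reduce at h0
    refine ((isUnit_iff_isUnit_det _).1 hY'u).ne_zero (det_eq_zero_of_row_eq_zero j fun i => ?_)
    rw [hYπ, diagonal_mul, h0, zero_mul]
  · intro j h0
    beta_reduce at h0
    refine ((isUnit_iff_isUnit_det _).1 hX'u).ne_zero
      (det_eq_zero_of_column_eq_zero j fun i => ?_)
    rw [hXπ, mul_diagonal, h0, mul_zero]
  · change X = _
    rw [mul_assoc L, ← hXπ, hX']
    simp only [mul_assoc, mul_inv_of_invertible, mul_one, mul_inv_cancel_left_of_invertible]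
  · change Y = _
    rw [mul_assoc U, ← hYπ, hY']
    simp only [mul_assoc, mul_inv_of_invertible, mul_one, mul_inv_cancel_left_of_invertible]

/-- Replacing inverses by adjugates in the parametrization of `S_π`. -/
lemma mem_Spi_iff {π : Equiv.Perm (Fin n)} {p : MatC n × MatC n} :
    p ∈ Spi π ↔ ∃ (L U : MatC n) (ds dt : Fin n → ℂ),
      L.det ≠ 0 ∧ (∀ i j : Fin n, i < j → L i j = 0) ∧
      U.det ≠ 0 ∧ (∀ i j : Fin n, j < i → U i j = 0) ∧
      (∀ i, ds i ≠ 0) ∧ (∀ i, dt i ≠ 0) ∧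
      p = (L * permMat π * diagonal dt * U.adjugate,
           U * diagonal ds * permMat π⁻¹ * L.adjugate) := by
  have hadj {M : MatC n} (hM : M.det ≠ 0) : M.adjugate = M.det • M⁻¹ := by
    rw [inv_def, Ring.inverse_eq_inv', smul_smul, mul_inv_cancel₀ hM, one_smul]
  have hdiag (c : ℂ) (d : Fin n → ℂ) : diagonal (fun i => c * d i) = c • diagonal d := by
    ext i j
    simp [diagonal_apply]
  constructor
  · rintro ⟨L, U, ds, dt, hLu, hL, hUu, hU, hs, ht, rfl⟩
    have hLd := ((isUnit_iff_isUnit_det _).1 hLu).ne_zero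
    have hUd := ((isUnit_iff_isUnit_det _).1 hUu).ne_zero
    refine ⟨L, U, fun i => L.det⁻¹ * ds i, fun i => U.det⁻¹ * dt i, hLd, hL, hUd, hU,
      fun i => mul_ne_zero (inv_ne_zero hLd) (hs i), fun i => mul_ne_zero (inv_ne_zero hUd) (ht i),
      ?_⟩
    simp [hadj hLd, hadj hUd, hdiag, smul_smul, hLd, hUd]
  · rintro ⟨L, U, ds, dt, hLd, hL, hUd, hU, hs, ht, rfl⟩
    refine ⟨L, U, fun i => L.det * ds i, fun i => U.det * dt i,
      (isUnit_iff_isUnit_det _).2 hLd.isUnit, hL, (isUnit_iff_isUnit_det _).2 hUd.isUnit, hU,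
      fun i => mul_ne_zero hLd (hs i), fun i => mul_ne_zero hUd (ht i), ?_⟩
    simp [hadj hLd, hadj hUd, hdiag]

lemma mk_permMat_mem_Spi (π : Equiv.Perm (Fin n)) {ds : Fin n → ℂ} (hs : ∀ i, ds i ≠ 0) :
    (permMat π, diagonal ds * permMat π⁻¹) ∈ Spi π :=
  ⟨1, 1, ds, fun _ => 1, isUnit_one, fun _ _ h => one_apply_ne h.ne, isUnit_one,
    fun _ _ h => one_apply_ne h.ne', hs, fun _ => one_ne_zero, by simp⟩

/-- Two points of `S_π` are joined by a polynomial curve that generically stays in `S_π`. -/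
lemma exists_curve_Spi {π : Equiv.Perm (Fin n)} {p q : MatC n × MatC n} (hp : p ∈ Spi π)
    (hq : q ∈ Spi π) : ∃ A B : Matrix (Fin n) (Fin n) ℂ[X],
      (A.map (eval 0), B.map (eval 0)) = p ∧ (A.map (eval 1), B.map (eval 1)) = q ∧
      ∀ᶠ z in cofinite, (A.map (eval z), B.map (eval z)) ∈ Spi π := by
  obtain ⟨L, U, s, t, hLd, hL, hUd, hU, hs, ht, rfl⟩ := mem_Spi_iff.1 hp
  obtain ⟨L', U', s', t', hLd', hL', hUd', hU', hs', ht', rfl⟩ := mem_Spi_iff.1 hq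
  let ds : Fin n → ℂ[X] := fun i => C (s i) + X * C (s' i - s i)
  let dt : Fin n → ℂ[X] := fun i => C (t i) + X * C (t' i - t i)
  let A := pencil L (L' - L) * (permMat π).map C * diagonal dt * (pencil U (U' - U)).adjugate
  let B := pencil U (U' - U) * diagonal ds * (permMat π⁻¹).map C * (pencil L (L' - L)).adjugate
  have hdiag (d : Fin n → ℂ[X]) (z : ℂ) :
      (diagonal d).map (eval z) = diagonal fun i => (d i).eval z :=
    diagonal_map eval_zero
  have hC (M : MatC n) (z : ℂ) : (M.map C).map (eval z) = M := by
    ext i j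
    simp
  have hmul (M N : Matrix (Fin n) (Fin n) ℂ[X]) (z : ℂ) :
      (M * N).map (eval z) = M.map (eval z) * N.map (eval z) :=
    Matrix.map_mul (f := evalRingHom z)
  have hadj (M : Matrix (Fin n) (Fin n) ℂ[X]) (z : ℂ) :
      M.adjugate.map (eval z) = (M.map (eval z)).adjugate :=
    (evalRingHom z).map_adjugate M
  have hdet (M : Matrix (Fin n) (Fin n) ℂ[X]) (z : ℂ) :
      M.det.eval z = (M.map (eval z)).det :=
    (evalRingHom z).map_det M
  have hA (z : ℂ) : A.map (eval z) = (L + z • (L' - L)) * permMat π *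
      diagonal (fun i => (dt i).eval z) * (U + z • (U' - U)).adjugate := by
    simp only [A, hmul, hadj, hC, hdiag, pencil_map_eval]
  have hB (z : ℂ) : B.map (eval z) = (U + z • (U' - U)) *
      diagonal (fun i => (ds i).eval z) * permMat π⁻¹ * (L + z • (L' - L)).adjugate := by
    simp only [B, hmul, hadj, hC, hdiag, pencil_map_eval]
  refine ⟨A, B, ?_, ?_, ?_⟩
  · simp [hA, hB, ds, dt]
  · simp [hA, hB, ds, dt]
  have hne {F : ℂ[X]} (h : F.eval 0 ≠ 0) : F ≠ 0 := by
    rintro rfl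
    simp at h
  have hdetne {M : MatC n} (M' : MatC n) (hM : M.det ≠ 0) :
      ∀ᶠ z : ℂ in cofinite, (M + z • M').det ≠ 0 := by
    filter_upwards [eventually_cofinite_eval_ne_zero (p := (pencil M M').det)
      (hne (by simpa [hdet] using hM))] with z hz
    simpa [hdet] using hz
  filter_upwards [hdetne (L' - L) hLd, hdetne (U' - U) hUd,
    eventually_all.2 fun i => eventually_cofinite_eval_ne_zero (p := ds i)
      (hne (by simpa [ds] using hs i)),
    eventually_all.2 fun i => eventually_cofinite_eval_ne_zero (p := dt i)
      (hne (by simpa [dt] using ht i))] with z hLz hUz hsz htz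
  rw [hA, hB]
  refine mem_Spi_iff.2 ⟨_, _, _, _, hLz, fun i j hij => ?_, hUz, fun i j hij => ?_, hsz, htz, rfl⟩
  · simp [hL i j hij, hL' i j hij]
  · simp [hU i j hij, hU' i j hij]

lemma isPrime_vanishingIdeal_Spi (π : Equiv.Perm (Fin n)) :
    (vanishingIdeal n (Spi π)).IsPrime := by
  refine Ideal.isPrime_iff.2 ⟨fun h => ?_, fun {f g} hfg => ?_⟩
  · have h1 := mem_vanishingIdeal_iff.1 ((Ideal.eq_top_iff_one _).1 h) _
      (mk_permMat_mem_Spi π (ds := fun _ => 1) fun _ => one_ne_zero)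
    simp at h1
  · by_contra! h
    simp only [mem_vanishingIdeal_iff, not_forall] at h
    obtain ⟨⟨p, hp, hfp⟩, q, hq, hgq⟩ := h
    obtain ⟨A, B, h0, h1, hev⟩ := exists_curve_Spi hp hq
    obtain ⟨F, hF⟩ := exists_eval_eq_evalPt A B f
    obtain ⟨G, hG⟩ := exists_eval_eq_evalPt A B g
    have hF0 : F ≠ 0 := by
      rintro rfl
      exact hfp (by simpa [h0] using (hF 0).symm)
    have hG0 : G ≠ 0 := by
      rintro rfl
      exact hgq (by simpa [h1] using (hG 1).symm)
    obtain ⟨z, hz, hFz, hGz⟩ := (hev.and ((eventually_cofinite_eval_ne_zero hF0).and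
      (eventually_cofinite_eval_ne_zero hG0))).exists
    have := mem_vanishingIdeal_iff.1 hfg _ hz
    rw [map_mul, ← hF, ← hG] at this
    exact mul_ne_zero hFz hGz this

end PermutationStrata

section Components

variable {n : ℕ}

lemma evalPt_Xgen_mul_Ygen (X Y : MatC n) (i j : Fin n) :
    evalPt n (X, Y) ((Xgen n * Ygen n) i j) = (X * Y) i j := by
  simp [evalPt, Xgen, Ygen, mul_apply]

lemma evalPt_Ygen_mul_Xgen (X Y : MatC n) (i j : Fin n) :
    evalPt n (X, Y) ((Ygen n * Xgen n) i j) = (Y * X) i j := by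
  simp [evalPt, Xgen, Ygen, mul_apply]

lemma upperLowerIdeal_le_vanishingIdeal_Spi (π : Equiv.Perm (Fin n)) :
    upperLowerIdeal n ≤ vanishingIdeal n (Spi π) := by
  refine Ideal.span_le.2 ?_
  rintro _ (⟨i, j, hij, rfl⟩ | ⟨i, j, hij, rfl⟩) <;>
    refine mem_vanishingIdeal_iff.2 fun ⟨X, Y⟩ hp => ?_
  · rw [evalPt_Xgen_mul_Ygen]
    exact (triangular_of_mem_Spi hp).1 hij
  · rw [evalPt_Ygen_mul_Xgen]
    exact (triangular_of_mem_Spi hp).2.1 hij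

lemma eq_of_vanishingIdeal_Spi_le {ρ π : Equiv.Perm (Fin n)}
    (h : vanishingIdeal n (Spi ρ) ≤ vanishingIdeal n (Spi π)) : ρ = π := by
  ext i : 1
  have hmem : (Xgen n * Ygen n) i i - (Ygen n * Xgen n) (ρ i) (ρ i) ∈
      vanishingIdeal n (Spi ρ) := mem_vanishingIdeal_iff.2 fun ⟨X, Y⟩ hp => by
    rw [map_sub, evalPt_Xgen_mul_Ygen, evalPt_Ygen_mul_Xgen, (triangular_of_mem_Spi hp).2.2 i,
      sub_self]
  have := mem_vanishingIdeal_iff.1 (h hmem) _ (mk_permMat_mem_Spi π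
    (ds := fun i => (i : ℂ) + 1) fun i => Nat.cast_add_one_ne_zero _)
  rw [map_sub, evalPt_Xgen_mul_Ygen, evalPt_Ygen_mul_Xgen, mul_assoc (diagonal _),
    permMat_inv_mul, mul_one, ← mul_assoc, permMat_mul_diagonal_mul_inv] at this
  simpa [sub_eq_zero, Fin.ext_iff] using (sub_eq_zero.1 this).symm

lemma exists_isUnit_mul_triangular (Y : MatC n) :
    ∃ N : MatC n, IsUnit N ∧ (Y * N).IsUpperTriangular ∧ (N * Y).IsLowerTriangular := by
  obtain ⟨N, hN, hYN, hNY, -⟩ := hasAdaptedFactor (ι := (Fin n)ᵒᵈ) (d := fun _ => (1 : ℂ))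
    (fun _ => one_ne_zero) Y
  exact ⟨N, hN, fun _ _ hij => hYN hij, fun _ _ hij => hNY hij⟩

/-- A polynomial vanishing on every `S_π` vanishes on the whole scheme. -/
lemma evalPt_eq_zero_of_forall_mem {f : PolyRing n} (hf : ∀ π, f ∈ vanishingIdeal n (Spi π))
    {X Y : MatC n} (hXY : (X * Y).IsLowerTriangular) (hYX : (Y * X).IsUpperTriangular) :
    evalPt n (X, Y) f = 0 := by
  have hd0 : ∀ i : Fin n, (i : ℂ) + 1 ≠ 0 := fun i => Nat.cast_add_one_ne_zero _
  have hd : Function.Injective fun i : Fin n => (i : ℂ) + 1 := fun i j h => by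
    simpa [Fin.ext_iff] using h
  have hfS : f ∈ vanishingIdeal n (⋃ π, Spi π) := mem_vanishingIdeal_iff.2 fun p hp => by
    obtain ⟨π, hp⟩ := Set.mem_iUnion.1 hp
    exact mem_vanishingIdeal_iff.1 (hf π) p hp
  have hunit : ∀ {X Y : MatC n}, IsUnit X → (X * Y).IsLowerTriangular →
      (Y * X).IsUpperTriangular → evalPt n (X, Y) f = 0 := by
    intro X Y hX hXY hYX
    obtain ⟨N, hN, hXN, hNX, hdiag⟩ := hasAdaptedFactor hd0 X
    refine evalPt_eq_zero_of_eventually hfS (A' := 0) (B' := N) ?_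
    filter_upwards [eventually_isUnit_add_smul Y hN,
      eventually_injective_add_mul (fun i => (X * Y) i i) hd] with z hz hinj
    rw [smul_zero, add_zero, Set.mem_iUnion]
    refine exists_mem_Spi hX hz ?_ ?_ ?_
    · rw [mul_add, mul_smul_comm]
      exact hXY.add fun i j hij => by simp [hXN hij]
    · rw [add_mul, smul_mul_assoc]
      exact hYX.add fun i j hij => by simp [hNX hij]
    · simpa [mul_add, hdiag hX] using hinj
  obtain ⟨N, hN, hYN, hNY⟩ := exists_isUnit_mul_triangular Y
  have hS : f ∈ vanishingIdeal n {p | IsUnit p.1 ∧ (p.1 * p.2).IsLowerTriangular ∧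
      (p.2 * p.1).IsUpperTriangular} :=
    mem_vanishingIdeal_iff.2 fun p hp => hunit hp.1 hp.2.1 hp.2.2
  refine evalPt_eq_zero_of_eventually hS (A' := N) (B' := 0) ?_
  filter_upwards [eventually_isUnit_add_smul X hN] with z hz
  rw [smul_zero, add_zero]
  refine ⟨hz, ?_, ?_⟩
  · rw [add_mul, smul_mul_assoc]
    exact hXY.add fun i j hij => by simp [hNY hij]
  · rw [mul_add, mul_smul_comm]
    exact hYX.add fun i j hij => by simp [hYN hij]

lemma inf_vanishingIdeal_Spi_le_radical :
    Finset.univ.inf (fun π : Equiv.Perm (Fin n) => vanishingIdeal n (Spi π)) ≤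
      (upperLowerIdeal n).radical := by
  intro f hf
  have hf' : ∀ π, f ∈ vanishingIdeal n (Spi π) := fun π => by
    exact (Finset.inf_le (f := fun π => vanishingIdeal n (Spi π)) (Finset.mem_univ π)) hf
  rw [← MvPolynomial.vanishingIdeal_zeroLocus_eq_radical (K := ℂ)]
  intro x hx
  have heval (g : PolyRing n) : MvPolynomial.aeval x g =
      evalPt n (of fun i j => x (Sum.inl (i, j)), of fun i j => x (Sum.inr (i, j))) g := by
    rw [evalPt, MvPolynomial.aeval_eq_eval]
    congr 2
    funext q
    rcases q with q | q <;> rfl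
  rw [heval]
  refine evalPt_eq_zero_of_forall_mem hf' (fun i j hij => ?_) fun i j hij => ?_
  · rw [← evalPt_Xgen_mul_Ygen, ← heval]
    exact hx _ (Ideal.subset_span (Or.inl ⟨i, j, hij, rfl⟩))
  · rw [← evalPt_Ygen_mul_Xgen, ← heval]
    exact hx _ (Ideal.subset_span (Or.inr ⟨i, j, hij, rfl⟩))

end Components

/-- The minimal primes over `J` are exactly the vanishing ideals `𝕀(S_π)` for
`π ∈ Sₙ`, and distinct permutations give distinct components. -/
theorem stmt5 (n : ℕ) (hn : 1 ≤ n) :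
    (upperLowerIdeal n).minimalPrimes =
      Set.range (fun π : Equiv.Perm (Fin n) => vanishingIdeal n (Spi π)) ∧
    Function.Injective (fun π : Equiv.Perm (Fin n) => vanishingIdeal n (Spi π)) := by
  refine ⟨?_, fun ρ π h => eq_of_vanishingIdeal_Spi_le h.le⟩
  have hle {P : Ideal (PolyRing n)} (hP : P ∈ (upperLowerIdeal n).minimalPrimes) :
      ∃ π, vanishingIdeal n (Spi π) = P := by
    obtain ⟨⟨hprime, hJP⟩, hmin⟩ := hP
    obtain ⟨π, -, hπ⟩ := hprime.inf_le'.1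
      (inf_vanishingIdeal_Spi_le_radical.trans (hprime.radical_le_iff.2 hJP))
    exact ⟨π, hπ.antisymm (hmin ⟨isPrime_vanishingIdeal_Spi π,
      upperLowerIdeal_le_vanishingIdeal_Spi π⟩ hπ)⟩
  ext P
  refine ⟨hle, ?_⟩
  rintro ⟨π, rfl⟩
  have := isPrime_vanishingIdeal_Spi π
  obtain ⟨Q, hQ, hQπ⟩ := Ideal.exists_minimalPrimes_le (upperLowerIdeal_le_vanishingIdeal_Spi π)
  obtain ⟨ρ, rfl⟩ := hle hQ
  rwa [eq_of_vanishingIdeal_Spi_le hQπ] at hQ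
end
end

section
/- Let π ∈ Sₙ with permutation matrix P_π, and let s, t be invertible diagonal n×n complex matrices such that the products sᵢtᵢ of corresponding diagonal entries are pairwise distinct (equivalently s_j/s_i ≠ t_i/t_j for all i ≠ j). Then the linear map sending a pair (A,B) of n×n complex matrices to the pair of strictly lower triangular parts of (A·sP_π⁻¹ + P_πt·B, sP_π⁻¹·A + B·P_πt) is surjective onto the space of pairs of strictly lower triangular matrices. (That is, (P_πt, sP_π⁻¹) is a smooth point of the upper-upper scheme E, the differential of the defining equations being onto.) -/
noncomputable section

/-- The strictly lower triangular part of a matrix: it agrees with `M` in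
entries `(i,j)` with `i > j` and is zero elsewhere. -/
def lowPart {n : ℕ} (M : MatC n) : MatC n :=
  Matrix.of fun i j => if j < i then M i j else 0

theorem mul_diagonal_permMat_inv_apply {n : ℕ} (A : MatC n) (d : Fin n → ℂ)
    (π : Equiv.Perm (Fin n)) (i j : Fin n) :
    (A * (Matrix.diagonal d * permMat π⁻¹)) i j = A i (π j) * d (π j) := by
  rw [Matrix.mul_apply]
  simp [permMat, Equiv.symm_apply_eq]

theorem permMat_mul_diagonal_mul_apply {n : ℕ} (B : MatC n) (d : Fin n → ℂ)
    (π : Equiv.Perm (Fin n)) (i j : Fin n) :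
    ((permMat π * Matrix.diagonal d) * B) i j = d (π i) * B (π i) j := by
  rw [Matrix.mul_apply]
  simp [permMat]

theorem diagonal_mul_permMat_inv_mul_apply {n : ℕ} (A : MatC n) (d : Fin n → ℂ)
    (π : Equiv.Perm (Fin n)) (i j : Fin n) :
    ((Matrix.diagonal d * permMat π⁻¹) * A) i j = d i * A (π⁻¹ i) j := by
  rw [Matrix.mul_apply]
  simp [permMat]

theorem mul_permMat_mul_diagonal_apply {n : ℕ} (B : MatC n) (d : Fin n → ℂ)
    (π : Equiv.Perm (Fin n)) (i j : Fin n) :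
    (B * (permMat π * Matrix.diagonal d)) i j = B i (π⁻¹ j) * d j := by
  rw [Matrix.mul_apply]
  simp [permMat, ← Equiv.eq_symm_apply]

/-- If `s, t` are invertible diagonal matrices with the products `sᵢtᵢ` pairwise
distinct, then the map sending `(A,B)` to the strictly lower triangular parts
of `(A·sP_{π⁻¹} + P_πt·B, sP_{π⁻¹}·A + B·P_πt)` is surjective onto pairs of
strictly lower triangular matrices: `(P_πt, sP_{π⁻¹})` is a smooth point of the
upper-upper scheme. -/
theorem stmt10 (n : ℕ) (hn : 1 ≤ n) (π : Equiv.Perm (Fin n))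
    (ds dt : Fin n → ℂ) (hs : ∀ i, ds i ≠ 0) (ht : ∀ i, dt i ≠ 0)
    (hgen : ∀ i j : Fin n, i ≠ j → ds i * dt i ≠ ds j * dt j) :
    ∀ C D : MatC n, (∀ i j : Fin n, i ≤ j → C i j = 0) →
      (∀ i j : Fin n, i ≤ j → D i j = 0) →
      ∃ A B : MatC n,
        lowPart (A * (Matrix.diagonal ds * permMat π⁻¹)
            + (permMat π * Matrix.diagonal dt) * B) = C ∧
        lowPart ((Matrix.diagonal ds * permMat π⁻¹) * A
            + B * (permMat π * Matrix.diagonal dt)) = D := by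
  intro C D hC hD
  refine ⟨Matrix.of fun i m => (dt m * C i (π⁻¹ m) - dt (π i) * D (π i) m) /
      (ds m * dt m - ds (π i) * dt (π i)),
    Matrix.of fun k j => (ds (π j) * D k (π j) - ds k * C (π⁻¹ k) j) /
      (ds (π j) * dt (π j) - ds k * dt k), ?_, ?_⟩
  · ext i j
    by_cases hij : j < i
    · have h := sub_ne_zero.2 (hgen (π j) (π i) (π.injective.ne hij.ne))
      simp only [lowPart, Matrix.of_apply, if_pos hij, Matrix.add_apply,
        mul_diagonal_permMat_inv_apply, permMat_mul_diagonal_mul_apply]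
      simp only [Equiv.Perm.inv_def, Equiv.symm_apply_apply]
      rw [div_mul_eq_mul_div, ← mul_div_assoc, ← add_div, div_eq_iff h]
      ring
    · simp [lowPart, hij, hC i j (not_lt.1 hij)]
  · ext i j
    by_cases hij : j < i
    · have h := sub_ne_zero.2 (hgen j i hij.ne)
      simp only [lowPart, Matrix.of_apply, if_pos hij, Matrix.add_apply,
        diagonal_mul_permMat_inv_mul_apply, mul_permMat_mul_diagonal_apply]
      simp only [Equiv.Perm.inv_def, Equiv.apply_symm_apply]
      rw [div_mul_eq_mul_div, ← mul_div_assoc, ← add_div, div_eq_iff h]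
      ring
    · simp [lowPart, hij, hD i j (not_lt.1 hij)]
end
end

section
/- Let X, Y be n×n complex matrices such that the commutator XY − YX is a diagonal matrix and XY − YX ≠ 0. Then the n×2n complex matrix C whose columns are the diagonals of X⁰, X¹, …, X^{n−1} followed by the diagonals of Y⁰, Y¹, …, Y^{n−1} (i.e. C_{i,k} = (X^{k−1})_{ii} and C_{i,n+k} = (Y^{k−1})_{ii} for 1 ≤ k ≤ n) has rank at most n − 1. -/
noncomputable section

/-- A matrix with a nontrivial left annihilator does not have full row rank. -/
theorem rank_lt_card_of_vecMul_eq_zero {m k K : Type*} [Fintype m] [Fintype k] [Field K]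
    {A : Matrix m k K} {v : m → K} (hv : v ≠ 0) (h : Matrix.vecMul v A = 0) :
    A.rank < Fintype.card m := by
  have hker : 0 < Module.finrank K (LinearMap.ker A.transpose.mulVecLin) := by
    refine Module.finrank_pos_iff_exists_ne_zero.mpr
      ⟨⟨v, ?_⟩, fun h0 => hv (congrArg Subtype.val h0)⟩
    simpa [Matrix.mulVec_transpose] using h
  have hrn := LinearMap.finrank_range_add_finrank_ker A.transpose.mulVecLin
  rw [Module.finrank_fintype_fun_eq_card] at hrn
  rw [← Matrix.rank_transpose, Matrix.rank]
  omega

/-- The trace of a commutator times a matrix commuting with its first entry vanishes. -/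
theorem trace_commutator_mul_eq_zero_of_commute {m R : Type*} [Fintype m] [CommRing R]
    {X Z : Matrix m m R} (Y : Matrix m m R) (h : Commute X Z) :
    ((X * Y - Y * X) * Z).trace = 0 := by
  rw [sub_mul, Matrix.trace_sub, Matrix.mul_assoc Y, h.eq, ← Matrix.mul_assoc Y,
    Matrix.trace_mul_comm (Y * Z), Matrix.mul_assoc X, sub_self]

theorem trace_mul_eq_sum_diag_of_isDiag {m R : Type*} [Fintype m] [Semiring R]
    {D : Matrix m m R} (hD : D.IsDiag) (Z : Matrix m m R) :
    (D * Z).trace = ∑ i, D i i * Z i i := by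
  refine Finset.sum_congr rfl fun i _ => ?_
  rw [Matrix.diag_apply, Matrix.mul_apply]
  refine Fintype.sum_eq_single i fun j hj => ?_
  rw [hD hj.symm, zero_mul]

/-- If `XY - YX` is a nonzero diagonal matrix, then the `n × 2n` matrix whose
columns are the diagonals of `X⁰, …, X^{n-1}` followed by the diagonals of
`Y⁰, …, Y^{n-1}` has rank at most `n - 1`. -/
theorem stmt11 (n : ℕ) (hn : 1 ≤ n) (X Y : MatC n)
    (hdiag : ∀ i j : Fin n, i ≠ j → (X * Y - Y * X) i j = 0)
    (hne : X * Y - Y * X ≠ 0) :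
    (Matrix.of fun (i : Fin n) (k : Fin n ⊕ Fin n) =>
        Sum.elim (fun a : Fin n => (X ^ (a : ℕ)) i i)
                 (fun a : Fin n => (Y ^ (a : ℕ)) i i) k).rank ≤ n - 1 := by
  have hD : (X * Y - Y * X).IsDiag := fun i j hij => hdiag i j hij
  have hv : (X * Y - Y * X).diag ≠ 0 := by
    intro h0
    apply hne
    ext i j
    rcases eq_or_ne i j with rfl | hij
    · exact congrFun h0 i
    · exact hdiag i j hij
  refine Nat.le_sub_one_of_lt ?_
  refine (rank_lt_card_of_vecMul_eq_zero hv ?_).trans_eq (Fintype.card_fin n)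
  ext k
  rcases k with a | a
  · exact (trace_mul_eq_sum_diag_of_isDiag hD _).symm.trans
      (trace_commutator_mul_eq_zero_of_commute Y (Commute.self_pow X a))
  · refine (trace_mul_eq_sum_diag_of_isDiag hD (Y ^ (a : ℕ))).symm.trans ?_
    rw [← neg_sub, neg_mul, Matrix.trace_neg,
      trace_commutator_mul_eq_zero_of_commute X (Commute.self_pow Y a), neg_zero]
    rfl
end
end

section
/- Let X, Y be n×n complex matrices such that the commutator XY − YX is diagonal and nonzero. Then the linear projection 'take the diagonal' from C_X + C_Y to ℂⁿ is not surjective: there exists d ∈ ℂⁿ such that for all Z₁ with Z₁X = XZ₁ and all Z₂ with Z₂Y = YZ₂, the diagonal of Z₁ + Z₂ is not equal to d. -/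
noncomputable section

open Matrix in
theorem Matrix.trace_commutator_mul_of_commute_left {ι R : Type*} [Fintype ι] [CommRing R]
    {X Y Z : Matrix ι ι R} (h : Z * X = X * Z) : trace ((X * Y - Y * X) * Z) = 0 := by
  rw [sub_mul, trace_sub, sub_eq_zero, mul_assoc Y, ← h, ← mul_assoc Y, trace_mul_comm (Y * Z),
    mul_assoc]

open Matrix in
theorem Matrix.trace_commutator_mul_of_commute_right {ι R : Type*} [Fintype ι] [CommRing R]
    {X Y Z : Matrix ι ι R} (h : Z * Y = Y * Z) : trace ((X * Y - Y * X) * Z) = 0 := by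
  rw [← neg_sub, neg_mul, trace_neg, trace_commutator_mul_of_commute_left h, neg_zero]

/-- If `XY - YX` is diagonal and nonzero, then the projection "take the
diagonal" from `C_X + C_Y` to `ℂⁿ` is not surjective: some `d ∈ ℂⁿ` is not the
diagonal of any `Z₁ + Z₂` with `Z₁` commuting with `X` and `Z₂` with `Y`. -/
theorem stmt13 (n : ℕ) (hn : 1 ≤ n) (X Y : MatC n)
    (hdiag : ∀ i j : Fin n, i ≠ j → (X * Y - Y * X) i j = 0)
    (hne : X * Y - Y * X ≠ 0) :
    ∃ d : Fin n → ℂ, ∀ Z₁ Z₂ : MatC n,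
      Z₁ * X = X * Z₁ → Z₂ * Y = Y * Z₂ →
      (fun i => (Z₁ + Z₂) i i) ≠ d := by
  have hD : X * Y - Y * X = Matrix.diagonal (X * Y - Y * X).diag :=
    ((Matrix.isDiag_iff_diagonal_diag _).1 fun i j hij => hdiag i j hij).symm
  obtain ⟨k, hk⟩ : ∃ k, (X * Y - Y * X).diag k ≠ 0 := by
    by_contra! h
    exact hne (by rw [hD, funext h]; exact Matrix.diagonal_zero)
  refine ⟨Pi.single k 1, fun Z₁ Z₂ h₁ h₂ hd => hk ?_⟩
  have htr : Matrix.trace ((X * Y - Y * X) * (Z₁ + Z₂)) = 0 := by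
    rw [mul_add, Matrix.trace_add, Matrix.trace_commutator_mul_of_commute_left h₁,
      Matrix.trace_commutator_mul_of_commute_right h₂, add_zero]
  rw [hD] at htr
  simp only [Matrix.trace, Matrix.diag_apply, Matrix.diagonal_mul] at htr
  simp only [fun i => congrFun hd i] at htr
  simpa [Pi.single_apply] using htr
end
end

section
/- Let π ∈ Sₙ and let w₀ ∈ Sₙ be the longest permutation i ↦ n+1−i, with permutation matrix also denoted w₀ (the antidiagonal matrix). The map (X,Y) ↦ (w₀Xᵀw₀, w₀Yᵀw₀) is a bijection from E_π onto E_{w₀π⁻¹w₀}. -/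
open Matrix

noncomputable section

/-- `M` is upper triangular: `M_{ij} = 0` for `i > j`. -/
def IsUpperTri {n : ℕ} (M : MatC n) : Prop := ∀ i j : Fin n, j < i → M i j = 0

/-- The stratum `E_π = {(X,Y) : X ∈ B₊P_πB₊, XY and YX upper triangular}`. -/
def Epi {n : ℕ} (π : Equiv.Perm (Fin n)) : Set (MatC n × MatC n) :=
  { p | (∃ B₁ B₂ : MatC n, IsUnit B₁ ∧ IsUpperTri B₁ ∧ IsUnit B₂ ∧ IsUpperTri B₂ ∧
          p.1 = B₁ * permMat π * B₂) ∧
        IsUpperTri (p.1 * p.2) ∧ IsUpperTri (p.2 * p.1) }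

/-- The reflection `X ↦ w₀Xᵀw₀` of a matrix across its antidiagonal. -/
def antitranspose {n : ℕ} (X : MatC n) : MatC n := Xᵀ.submatrix Fin.rev Fin.rev

theorem permMat_revPerm_mul_transpose_mul {n : ℕ} (X : MatC n) :
    permMat Fin.revPerm * Xᵀ * permMat Fin.revPerm = antitranspose X := by
  ext i j
  have h (k : Fin n) : i.rev = k ↔ k = i.rev := eq_comm
  have h' (k : Fin n) : k.rev = j ↔ k = j.rev := Fin.rev_eq_iff
  simp [Matrix.mul_apply, permMat, antitranspose, h, h']

theorem antitranspose_antitranspose {n : ℕ} (X : MatC n) :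
    antitranspose (antitranspose X) = X := by
  ext i j
  simp [antitranspose]

theorem antitranspose_mul {n : ℕ} (X Y : MatC n) :
    antitranspose (X * Y) = antitranspose Y * antitranspose X := by
  rw [antitranspose, Matrix.transpose_mul]
  exact (Matrix.submatrix_mul_equiv Yᵀ Xᵀ Fin.rev Fin.revPerm Fin.rev).symm

theorem antitranspose_one {n : ℕ} : antitranspose (1 : MatC n) = 1 := by
  rw [antitranspose, Matrix.transpose_one]
  exact Matrix.submatrix_one_equiv Fin.revPerm

theorem IsUpperTri.antitranspose {n : ℕ} {X : MatC n} (hX : IsUpperTri X) :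
    IsUpperTri (antitranspose X) := fun _ _ hij =>
  hX _ _ (Fin.rev_lt_rev.mpr hij)

theorem isUnit_antitranspose {n : ℕ} {X : MatC n} (hX : IsUnit X) :
    IsUnit (antitranspose X) := by
  obtain ⟨Y, hXY, hYX⟩ := isUnit_iff_exists.mp hX
  refine isUnit_iff_exists.mpr ⟨antitranspose Y, ?_, ?_⟩
  · rw [← antitranspose_mul, hYX, antitranspose_one]
  · rw [← antitranspose_mul, hXY, antitranspose_one]

theorem antitranspose_permMat {n : ℕ} (π : Equiv.Perm (Fin n)) :
    antitranspose (permMat π) = permMat (Fin.revPerm * π⁻¹ * Fin.revPerm) := by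
  ext i j
  have h : π j.rev = i.rev ↔ (π⁻¹ i.rev).rev = j := by
    rw [Fin.rev_eq_iff, Equiv.Perm.inv_eq_iff_eq, eq_comm]
  simp [antitranspose, permMat, h]

theorem antitranspose_mem_Epi {n : ℕ} {π : Equiv.Perm (Fin n)} {p : MatC n × MatC n}
    (hp : p ∈ Epi π) :
    (antitranspose p.1, antitranspose p.2) ∈ Epi (Fin.revPerm * π⁻¹ * Fin.revPerm) := by
  obtain ⟨⟨B₁, B₂, hB₁, hB₁', hB₂, hB₂', hX⟩, hXY, hYX⟩ := hp
  refine ⟨⟨antitranspose B₂, antitranspose B₁, isUnit_antitranspose hB₂, hB₂'.antitranspose,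
    isUnit_antitranspose hB₁, hB₁'.antitranspose, ?_⟩, ?_, ?_⟩
  · simp only [hX, antitranspose_mul, antitranspose_permMat, mul_assoc]
  · simpa only [antitranspose_mul] using hYX.antitranspose
  · simpa only [antitranspose_mul] using hXY.antitranspose

/-- With `w₀` the longest permutation `i ↦ n+1-i` (whose permutation matrix is
the antidiagonal matrix), the map `(X,Y) ↦ (w₀Xᵀw₀, w₀Yᵀw₀)` is a bijection
from `E_π` onto `E_{w₀π⁻¹w₀}`. -/
theorem stmt15 (n : ℕ) (hn : 1 ≤ n) (π : Equiv.Perm (Fin n)) :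
    Set.BijOn
      (fun p : MatC n × MatC n =>
        (permMat ((Fin.revPerm : Equiv.Perm (Fin n))) * p.1ᵀ * permMat ((Fin.revPerm : Equiv.Perm (Fin n))),
         permMat ((Fin.revPerm : Equiv.Perm (Fin n))) * p.2ᵀ * permMat ((Fin.revPerm : Equiv.Perm (Fin n)))))
      (Epi π)
      (Epi (Fin.revPerm * π⁻¹ * Fin.revPerm)) := by
  simp only [permMat_revPerm_mul_transpose_mul]
  refine Set.InvOn.bijOn (f' := fun p => (antitranspose p.1, antitranspose p.2))
    ⟨fun p _ => ?_, fun p _ => ?_⟩ (fun p hp => antitranspose_mem_Epi hp) (fun p hp => ?_)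
  · simp only [antitranspose_antitranspose]
  · simp only [antitranspose_antitranspose]
  · have hπ : Fin.revPerm * (Fin.revPerm * π⁻¹ * Fin.revPerm)⁻¹ * Fin.revPerm = π := by
      ext i
      simp [_root_.mul_inv_rev, Equiv.Perm.inv_def]
    simpa only [hπ] using antitranspose_mem_Epi hp
end
end

section
/- For every π ∈ Sₙ, the image of E_π under the swap map (X,Y) ↦ (Y,X) has the same Zariski closure as E_{π⁻¹}; that is, 𝕀({(Y,X) : (X,Y) ∈ E_π}) = 𝕀(E_{π⁻¹}). -/
noncomputable section

theorem IsUpperTri.inv {n : ℕ} {M : MatC n} (hM : IsUnit M) (h : IsUpperTri M) :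
    IsUpperTri M⁻¹ := by
  have : Invertible M := hM.invertible
  exact Matrix.blockTriangular_inv_of_blockTriangular (b := id) h

theorem IsUpperTri.mul {n : ℕ} {M N : MatC n} (hM : IsUpperTri M) (hN : IsUpperTri N) :
    IsUpperTri (M * N) :=
  Matrix.BlockTriangular.mul (b := id) hM hN

theorem permMat_mul_permMat_inv {n : ℕ} (π : Equiv.Perm (Fin n)) :
    permMat π * permMat π⁻¹ = 1 := by
  ext i j
  simp only [permMat, Matrix.mul_apply, Matrix.of_apply, Matrix.one_apply, ite_mul, one_mul,
    zero_mul, Finset.sum_ite_eq, Finset.mem_univ, if_true]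
  simp

theorem isUnit_permMat {n : ℕ} (π : Equiv.Perm (Fin n)) : IsUnit (permMat π) :=
  IsUnit.of_mul_eq_one _ (permMat_mul_permMat_inv π)

theorem inv_permMat {n : ℕ} (π : Equiv.Perm (Fin n)) : (permMat π)⁻¹ = permMat π⁻¹ :=
  Matrix.inv_eq_right_inv (permMat_mul_permMat_inv π)

theorem isUnit_fst_of_mem_Epi {n : ℕ} {π : Equiv.Perm (Fin n)} {p : MatC n × MatC n}
    (hp : p ∈ Epi π) : IsUnit p.1 := by
  obtain ⟨⟨B₁, B₂, h₁, -, h₂, -, hX⟩, -⟩ := hp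
  rw [hX]
  exact (h₁.mul (isUnit_permMat π)).mul h₂

/-- If `Y` is invertible, then `Y = (YX)X⁻¹` lies in the Bruhat cell of `π⁻¹`. -/
theorem swap_mem_Epi_inv {n : ℕ} {π : Equiv.Perm (Fin n)} {p : MatC n × MatC n}
    (hp : p ∈ Epi π) (hY : IsUnit p.2) : p.swap ∈ Epi π⁻¹ := by
  have hX := isUnit_fst_of_mem_Epi hp
  obtain ⟨⟨B₁, B₂, h₁, h₁', h₂, h₂', hX'⟩, hXY, hYX⟩ := hp
  refine ⟨⟨p.2 * p.1 * B₂⁻¹, B₁⁻¹, ?_, hYX.mul (h₂'.inv h₂), ?_, h₁'.inv h₁, ?_⟩, hYX, hXY⟩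
  · exact (hY.mul hX).mul (Matrix.isUnit_nonsing_inv_iff.2 h₂)
  · exact Matrix.isUnit_nonsing_inv_iff.2 h₁
  · have hinv : p.1⁻¹ = B₂⁻¹ * permMat π⁻¹ * B₁⁻¹ := by
      rw [hX', Matrix.mul_inv_rev, Matrix.mul_inv_rev, inv_permMat, mul_assoc]
    rw [mul_assoc (p.2 * p.1), mul_assoc (p.2 * p.1), ← hinv,
      Matrix.mul_nonsing_inv_cancel_right _ _ ((Matrix.isUnit_iff_isUnit_det _).1 hX),
      Prod.fst_swap]

theorem isUpperTri_add_smul_one {n : ℕ} {M : MatC n} (hM : IsUpperTri M) (t : ℂ) :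
    IsUpperTri (M + t • 1) := by
  intro i j hij
  simp [hM i j hij, hij.ne']

theorem add_smul_inv_mem_Epi {n : ℕ} {π : Equiv.Perm (Fin n)} {p : MatC n × MatC n}
    (hp : p ∈ Epi π) (t : ℂ) : (p.1, p.2 + t • p.1⁻¹) ∈ Epi π := by
  have hX := (Matrix.isUnit_iff_isUnit_det _).1 (isUnit_fst_of_mem_Epi hp)
  obtain ⟨hB, hXY, hYX⟩ := hp
  refine ⟨hB, ?_, ?_⟩
  · simpa [mul_add, Matrix.mul_nonsing_inv _ hX] using isUpperTri_add_smul_one hXY t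
  · simpa [add_mul, Matrix.nonsing_inv_mul _ hX] using isUpperTri_add_smul_one hYX t

open Filter Topology in
theorem eventually_isUnit_add_smul_one {n : ℕ} (M : MatC n) :
    ∀ᶠ t : ℂ in 𝓝[≠] 0, IsUnit (M + t • 1) := by
  have hfin : {t : ℂ | (-M).charpoly.IsRoot t}.Finite :=
    Polynomial.finite_setOfPred_isRoot (-M).charpoly_monic.ne_zero
  filter_upwards [nhdsNE_of_nhdsNE_sdiff_finite univ_mem hfin] with t ht
  rw [Matrix.isUnit_iff_isUnit_det, isUnit_iff_ne_zero]
  intro h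
  apply ht.2
  rw [Set.mem_ofPred_eq, Polynomial.IsRoot, Matrix.eval_charpoly, ← h]
  congr 1
  rw [sub_neg_eq_add, add_comm, Matrix.smul_one_eq_diagonal]
  rfl

open Filter Topology in
/-- The pairs in `E_π` with invertible second entry are dense in `E_π`, because
`(X, Y + tX⁻¹) ∈ E_π` for every `t`. -/
theorem Epi_subset_closure_isUnit_snd {n : ℕ} (π : Equiv.Perm (Fin n)) :
    Epi π ⊆ closure {p ∈ Epi π | IsUnit p.2} := by
  intro p hp
  have hX := isUnit_fst_of_mem_Epi hp
  have hX' := (Matrix.isUnit_iff_isUnit_det _).1 hX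
  have hcont : Continuous fun t : ℂ => (p.1, p.2 + t • p.1⁻¹) := by fun_prop
  have htend : Tendsto (fun t : ℂ => (p.1, p.2 + t • p.1⁻¹)) (𝓝[≠] 0) (𝓝 p) := by
    simpa using (hcont.tendsto 0).mono_left nhdsWithin_le_nhds
  refine mem_closure_of_tendsto htend ?_
  filter_upwards [eventually_isUnit_add_smul_one (p.2 * p.1)] with t ht
  refine ⟨add_smul_inv_mem_Epi hp t, ?_⟩
  have hfac : p.2 + t • p.1⁻¹ = (p.2 * p.1 + t • 1) * p.1⁻¹ := by
    rw [add_mul, Matrix.mul_nonsing_inv_cancel_right _ _ hX', smul_mul_assoc, one_mul]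
  exact hfac ▸ ht.mul (Matrix.isUnit_nonsing_inv_iff.2 hX)

theorem mem_vanishingIdeal {n : ℕ} {S : Set (MatC n × MatC n)} {f : PolyRing n} :
    f ∈ vanishingIdeal n S ↔ ∀ p ∈ S, evalPt n p f = 0 := by
  simp only [vanishingIdeal, Ideal.mem_iInf, RingHom.mem_ker]

theorem continuous_evalPt {n : ℕ} (f : PolyRing n) : Continuous fun p => evalPt n p f := by
  refine (MvPolynomial.continuous_eval f).comp (continuous_pi ?_)
  rintro (q | q) <;> simp only [Sum.elim_inl, Sum.elim_inr] <;> fun_prop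

theorem vanishingIdeal_le_of_subset_closure {n : ℕ} {S T : Set (MatC n × MatC n)}
    (h : S ⊆ closure T) : vanishingIdeal n T ≤ vanishingIdeal n S := by
  intro f hf
  rw [mem_vanishingIdeal] at hf ⊢
  have hclosed : IsClosed {p | evalPt n p f = 0} :=
    isClosed_eq (continuous_evalPt f) continuous_const
  exact fun p hp => closure_minimal hf hclosed (h hp)

theorem swap_image_Epi_subset_closure {n : ℕ} (π : Equiv.Perm (Fin n)) :
    Prod.swap '' Epi π ⊆ closure (Epi π⁻¹) := by
  refine (Set.image_mono (Epi_subset_closure_isUnit_snd π)).trans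
    ((image_closure_subset_closure_image continuous_swap).trans (closure_mono ?_))
  rintro _ ⟨p, ⟨hp, hY⟩, rfl⟩
  exact swap_mem_Epi_inv hp hY

theorem Epi_inv_subset_closure_swap_image {n : ℕ} (π : Equiv.Perm (Fin n)) :
    Epi π⁻¹ ⊆ closure (Prod.swap '' Epi π) := by
  refine (Epi_subset_closure_isUnit_snd π⁻¹).trans (closure_mono ?_)
  rintro p ⟨hp, hY⟩
  exact ⟨p.swap, by simpa using swap_mem_Epi_inv hp hY, p.swap_swap⟩

/-- The image of `E_π` under the swap `(X,Y) ↦ (Y,X)` has the same Zariski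
closure as `E_{π⁻¹}`: their vanishing ideals coincide. -/
theorem stmt16 (n : ℕ) (hn : 1 ≤ n) (π : Equiv.Perm (Fin n)) :
    vanishingIdeal n ((fun p : MatC n × MatC n => (p.2, p.1)) '' Epi π) =
      vanishingIdeal n (Epi π⁻¹) :=
  le_antisymm (vanishingIdeal_le_of_subset_closure (Epi_inv_subset_closure_swap_image π))
    (vanishingIdeal_le_of_subset_closure (swap_image_Epi_subset_closure π))
end
end
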